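/- arXiv:2310.02495 — 6 statements merged into one kernel-verified Lean document; each statement's English description precedes it below -/
import Mathlib

section
/- Let F_q be a finite field with q elements of characteristic p, let k ≥ 2 with p ∤ k(k+1), let F ∈ F_q[x] be monic of degree n, let h be an integer with 0 < h < n, and suppose h < d ≤ n/k. Let S_q(d) be the set of monic polynomials G of degree d such that G^k·A ∈ I_q(F,h) for some monic polynomial A. If G_1, G_2, G_3 are three distinct polynomials in S_q(d), then max_{1 ≤ i < j ≤ 3} deg(G_i − G_j) ≥ ((k+2)d − n)/3. -/
open Polynomial

theorem natDegree_sub_le_of_both_le {R : Type*} [Ring R] {P Q : R[X]} {D : ℕ}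
    (hP : P.natDegree ≤ D) (hQ : Q.natDegree ≤ D) : (P - Q).natDegree ≤ D :=
  (natDegree_sub_le P Q).trans (max_le hP hQ)

/-- A sum of monic polynomials of common degree `D` has degree `D`, provided the number of
summands is nonzero in the coefficient ring. -/
theorem natDegree_sum_of_monic {R ι : Type*} [CommRing R] (s : Finset ι) (f : ι → R[X]) (D : ℕ)
    (hf : ∀ i ∈ s, (f i).Monic) (hD : ∀ i ∈ s, (f i).natDegree = D) (hs : (s.card : R) ≠ 0) :
    (∑ i ∈ s, f i).natDegree = D := by
  apply natDegree_eq_of_le_of_coeff_ne_zero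
  · exact natDegree_sum_le_of_forall_le s f fun i hi => (hD i hi).le
  · rw [finsetSum_coeff, Finset.sum_congr rfl (g := fun _ => (1 : R))]
    · simpa using hs
    · intro i hi
      have h := (hf i hi).coeff_natDegree
      rwa [hD i hi] at h

/-- The homogeneous symmetric sum `∑ x ^ j * y ^ (k - 1 - j)` at monic polynomials of degree `d`. -/
theorem natDegree_geom_sum₂ {K : Type*} [Field K] {k d : ℕ} (hk : (k : K) ≠ 0) {x y : K[X]}
    (hx : x.Monic) (hy : y.Monic) (hxd : x.natDegree = d) (hyd : y.natDegree = d) :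
    (∑ j ∈ Finset.range k, x ^ j * y ^ (k - 1 - j)).natDegree = (k - 1) * d := by
  apply natDegree_sum_of_monic
  · intro j _
    exact (hx.pow j).mul (hy.pow _)
  · intro j hj
    rw [Finset.mem_range] at hj
    rw [(hx.pow j).natDegree_mul (hy.pow _), hx.natDegree_pow, hy.natDegree_pow, hxd, hyd,
      ← add_mul]
    congr 1
    omega
  · simpa using hk

/-- The cofactor of the Vandermonde product in the alternating sum
`(y z) ^ k (y - z) - (x z) ^ k (x - z) + (x y) ^ k (x - y)`. -/
def alternantCofactor {R : Type*} [CommRing R] (k : ℕ) (x y z : R) : R :=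
  ∑ i ∈ Finset.range k, ∑ j ∈ Finset.range (i + 1),
    y ^ i * (x * z) ^ (k - 1 - i) * (x ^ j * z ^ (i - j))

theorem alternant_eq_mul_alternantCofactor {R : Type*} [CommRing R] (k : ℕ) (x y z : R) :
    (y * z) ^ k * (y - z) - (x * z) ^ k * (x - z) + (x * y) ^ k * (x - y) =
      (x - y) * (x - z) * (y - z) * alternantCofactor k x y z := by
  have key : (x - z) * alternantCofactor k x y z =
      x ^ k * (∑ i ∈ Finset.range k, y ^ i * z ^ (k - 1 - i)) -
        z ^ k * (∑ i ∈ Finset.range k, y ^ i * x ^ (k - 1 - i)) := by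
    rw [alternantCofactor, Finset.mul_sum, Finset.mul_sum, Finset.mul_sum,
      ← Finset.sum_sub_distrib]
    refine Finset.sum_congr rfl fun i hi => ?_
    rw [Finset.mem_range] at hi
    have hg := (Commute.all x z).geom_sum₂_mul (i + 1)
    simp only [Nat.add_sub_cancel] at hg
    rw [← Finset.mul_sum]
    obtain ⟨r, rfl⟩ : ∃ r, k = i + 1 + r := ⟨k - (i + 1), by omega⟩
    have hr : i + 1 + r - 1 - i = r := by omega
    rw [hr, pow_add x (i + 1) r, pow_add z (i + 1) r, mul_pow]
    linear_combination (y ^ i * (x ^ r * z ^ r)) * hg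
  have hyz := (Commute.all y z).geom_sum₂_mul k
  have hyx := (Commute.all y x).geom_sum₂_mul k
  simp only [mul_pow]
  linear_combination (-(x - y) * (y - z)) * key - (x - y) * x ^ k * hyz
    - (y - z) * z ^ k * hyx

theorem natDegree_alternantCofactor {K : Type*} [Field K] {k d : ℕ}
    (hk : (k : K) * (k + 1) ≠ 0) {x y z : K[X]} (hx : x.Monic) (hy : y.Monic) (hz : z.Monic)
    (hxd : x.natDegree = d) (hyd : y.natDegree = d) (hzd : z.natDegree = d) :
    (alternantCofactor k x y z).natDegree = (2 * k - 2) * d := by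
  rw [alternantCofactor, Finset.sum_sigma']
  apply natDegree_sum_of_monic
  · intro _ _
    exact ((hy.pow _).mul ((hx.mul hz).pow _)).mul ((hx.pow _).mul (hz.pow _))
  · rintro ⟨i, j⟩ hij
    simp only [Finset.mem_sigma, Finset.mem_range] at hij
    rw [((hy.pow _).mul ((hx.mul hz).pow _)).natDegree_mul ((hx.pow _).mul (hz.pow _)),
      (hy.pow _).natDegree_mul ((hx.mul hz).pow _), (hx.pow _).natDegree_mul (hz.pow _),
      (hx.mul hz).natDegree_pow, hx.natDegree_mul hz, hx.natDegree_pow, hy.natDegree_pow,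
      hz.natDegree_pow, hxd, hyd, hzd]
    dsimp only
    obtain ⟨r, rfl⟩ : ∃ r, k = i + 1 + r := ⟨k - (i + 1), by omega⟩
    obtain ⟨s, rfl⟩ : ∃ s, i = j + s := ⟨i - j, by omega⟩
    have h1 : j + s + 1 + r - 1 - (j + s) = r := by omega
    have h2 : j + s - j = s := by omega
    have h3 : 2 * (j + s + 1 + r) - 2 = 2 * (j + s + r) := by omega
    rw [h1, h2, h3]
    ring
  · intro h0
    apply hk
    have h2 : (∑ i ∈ Finset.range k, (i + 1)) * 2 = k * (k + 1) := by
      have := Finset.sum_range_id_mul_two (k + 1)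
      rw [Finset.sum_range_succ'] at this
      simpa [mul_comm] using this
    rw [Finset.card_sigma] at h0
    simp only [Finset.card_range] at h0
    have h3 := congrArg (Nat.cast : ℕ → K) h2
    rw [Nat.cast_mul, h0, zero_mul] at h3
    push_cast at h3
    exact h3.symm

/-- Two distinct monic polynomials of degree `d` whose `k`-th powers have multiples close to `F`
are far apart. -/
theorem natDegree_sub_ge_of_pow_mul_near {K : Type*} [Field K] {k n h d : ℕ} (hk : 2 ≤ k)
    (hkK : (k : K) ≠ 0) (hhd : h < d) (hdn : k * d ≤ n) {F G₁ G₂ A₁ A₂ : K[X]} (hF0 : F ≠ 0)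
    (hF : F.natDegree = n) (hG₁ : G₁.Monic) (hG₂ : G₂.Monic) (hd₁ : G₁.natDegree = d)
    (hd₂ : G₂.natDegree = d) (hR₁ : (F - G₁ ^ k * A₁).natDegree ≤ h)
    (hR₂ : (F - G₂ ^ k * A₂).natDegree ≤ h) (hne : G₁ ≠ G₂) :
    (k + 1) * d ≤ n + (G₁ - G₂).natDegree := by
  obtain ⟨l, rfl⟩ : ∃ l, k = l + 2 := ⟨k - 2, by omega⟩
  set T := ∑ j ∈ Finset.range (l + 2), G₁ ^ j * G₂ ^ (l + 2 - 1 - j) with hTdef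
  have hT : T.natDegree = (l + 1) * d := natDegree_geom_sum₂ hkK hG₁ hG₂ hd₁ hd₂
  have hT0 : T ≠ 0 := fun h0 => by
    rw [h0, natDegree_zero] at hT
    have : 0 < (l + 1) * d := Nat.mul_pos (by omega) (by omega)
    omega
  have hTmul : T * (G₁ - G₂) = G₁ ^ (l + 2) - G₂ ^ (l + 2) :=
    (Commute.all G₁ G₂).geom_sum₂_mul (l + 2)
  have hmain : (F * (T * (G₁ - G₂))).natDegree = n + ((l + 1) * d + (G₁ - G₂).natDegree) := by
    rw [natDegree_mul hF0 (mul_ne_zero hT0 (sub_ne_zero.2 hne)),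
      natDegree_mul hT0 (sub_ne_zero.2 hne), hF, hT]
  set R₁ := F - G₁ ^ (l + 2) * A₁ with hR₁def
  set R₂ := F - G₂ ^ (l + 2) * A₂ with hR₂def
  have herr : (R₂ * G₁ ^ (l + 2) - R₁ * G₂ ^ (l + 2)).natDegree ≤ h + (l + 2) * d := by
    apply natDegree_sub_le_of_both_le
    · exact natDegree_mul_le_of_le hR₂ (by rw [hG₁.natDegree_pow, hd₁])
    · exact natDegree_mul_le_of_le hR₁ (by rw [hG₂.natDegree_pow, hd₂])
  have hid : (A₂ - A₁) * (G₁ * G₂) ^ (l + 2) =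
      F * (T * (G₁ - G₂)) - (R₂ * G₁ ^ (l + 2) - R₁ * G₂ ^ (l + 2)) := by
    rw [hTmul, hR₁def, hR₂def]
    ring
  by_cases hA : A₂ - A₁ = 0
  · rw [hA, zero_mul, eq_comm, sub_eq_zero] at hid
    rw [← hid, hmain] at herr
    nlinarith
  · have hGG := (hG₁.mul hG₂).pow (l + 2)
    have hl : ((A₂ - A₁) * (G₁ * G₂) ^ (l + 2)).natDegree =
        (A₂ - A₁).natDegree + (l + 2) * (d + d) := by
      rw [natDegree_mul hA hGG.ne_zero, (hG₁.mul hG₂).natDegree_pow, hG₁.natDegree_mul hG₂,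
        hd₁, hd₂]
    have hr := natDegree_sub_le (F * (T * (G₁ - G₂)))
      (R₂ * G₁ ^ (l + 2) - R₁ * G₂ ^ (l + 2))
    rw [← hid, hl, hmain] at hr
    rcases le_max_iff.1 hr with hr | hr <;> nlinarith

theorem add_two_mul_le_add_three_mul_of_pow_mul_near {K : Type*} [Field K] {k n h d e : ℕ}
    (hk : 2 ≤ k) (hkK : (k : K) * (k + 1) ≠ 0) (hhd : h < d) (hdn : k * d ≤ n)
    {F G₁ G₂ G₃ A₁ A₂ A₃ : K[X]} (hF0 : F ≠ 0) (hF : F.natDegree = n)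
    (hG₁ : G₁.Monic) (hG₂ : G₂.Monic) (hG₃ : G₃.Monic)
    (hd₁ : G₁.natDegree = d) (hd₂ : G₂.natDegree = d) (hd₃ : G₃.natDegree = d)
    (hR₁ : (F - G₁ ^ k * A₁).natDegree ≤ h) (hR₂ : (F - G₂ ^ k * A₂).natDegree ≤ h)
    (hR₃ : (F - G₃ ^ k * A₃).natDegree ≤ h)
    (h12 : G₁ ≠ G₂) (h13 : G₁ ≠ G₃) (h23 : G₂ ≠ G₃)
    (he : max (max (G₁ - G₂).natDegree (G₁ - G₃).natDegree) (G₂ - G₃).natDegree = e) :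
    (k + 2) * d ≤ n + 3 * e := by
  by_contra! hlt
  have hk0 : (k : K) ≠ 0 := left_ne_zero_of_mul hkK
  have b12 := natDegree_sub_ge_of_pow_mul_near hk hk0 hhd hdn hF0 hF hG₁ hG₂ hd₁ hd₂ hR₁ hR₂ h12
  have b13 := natDegree_sub_ge_of_pow_mul_near hk hk0 hhd hdn hF0 hF hG₁ hG₃ hd₁ hd₃ hR₁ hR₃ h13
  have b23 := natDegree_sub_ge_of_pow_mul_near hk hk0 hhd hdn hF0 hF hG₂ hG₃ hd₂ hd₃ hR₂ hR₃ h23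
  have u12 : (G₁ - G₂).natDegree ≤ d := natDegree_sub_le_of_both_le hd₁.le hd₂.le
  have u13 : (G₁ - G₃).natDegree ≤ d := natDegree_sub_le_of_both_le hd₁.le hd₃.le
  have u23 : (G₂ - G₃).natDegree ≤ d := natDegree_sub_le_of_both_le hd₂.le hd₃.le
  have hS := natDegree_alternantCofactor hkK hG₁ hG₂ hG₃ hd₁ hd₂ hd₃
  obtain ⟨l, rfl⟩ : ∃ l, k = l + 2 := ⟨k - 2, by omega⟩
  rw [show 2 * (l + 2) - 2 = 2 * l + 2 by omega] at hS
  have hW := alternant_eq_mul_alternantCofactor (l + 2) G₁ G₂ G₃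
  set S := alternantCofactor (l + 2) G₁ G₂ G₃
  have hS0 : S ≠ 0 := fun h0 => by
    rw [h0, natDegree_zero] at hS
    have : 0 < (2 * l + 2) * d := Nat.mul_pos (by omega) (by omega)
    omega
  have n12 := sub_ne_zero.2 h12
  have n13 := sub_ne_zero.2 h13
  have n23 := sub_ne_zero.2 h23
  have hmain : (F * ((G₁ - G₂) * (G₁ - G₃) * (G₂ - G₃) * S)).natDegree =
      n + ((G₁ - G₂).natDegree + (G₁ - G₃).natDegree + (G₂ - G₃).natDegree
        + (2 * l + 2) * d) := by
    rw [natDegree_mul hF0 (mul_ne_zero (mul_ne_zero (mul_ne_zero n12 n13) n23) hS0),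
      natDegree_mul (mul_ne_zero (mul_ne_zero n12 n13) n23) hS0,
      natDegree_mul (mul_ne_zero n12 n13) n23, natDegree_mul n12 n13, hF, hS]
  set R₁ := F - G₁ ^ (l + 2) * A₁ with hR₁def
  set R₂ := F - G₂ ^ (l + 2) * A₂ with hR₂def
  set R₃ := F - G₃ ^ (l + 2) * A₃ with hR₃def
  have hterm {R X Y D : K[X]} (hR : R.natDegree ≤ h) (hX : X.Monic) (hY : Y.Monic)
      (hXd : X.natDegree = d) (hYd : Y.natDegree = d) (hD : D.natDegree ≤ e) :
      (R * ((X * Y) ^ (l + 2) * D)).natDegree ≤ h + ((l + 2) * (d + d) + e) := by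
    refine natDegree_mul_le_of_le hR (natDegree_mul_le_of_le ?_ hD)
    rw [(hX.mul hY).natDegree_pow, hX.natDegree_mul hY, hXd, hYd]
  set E := R₁ * ((G₂ * G₃) ^ (l + 2) * (G₂ - G₃)) - R₂ * ((G₁ * G₃) ^ (l + 2) * (G₁ - G₃))
    + R₃ * ((G₁ * G₂) ^ (l + 2) * (G₁ - G₂)) with hE
  have herr : E.natDegree ≤ h + ((l + 2) * (d + d) + e) := by
    refine natDegree_add_le_of_degree_le (natDegree_sub_le_of_both_le ?_ ?_) ?_
    · exact hterm hR₁ hG₂ hG₃ hd₂ hd₃ (by omega)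
    · exact hterm hR₂ hG₁ hG₃ hd₁ hd₃ (by omega)
    · exact hterm hR₃ hG₁ hG₂ hd₁ hd₂ (by omega)
  have hid : (A₁ * (G₂ - G₃) - A₂ * (G₁ - G₃) + A₃ * (G₁ - G₂)) * (G₁ * G₂ * G₃) ^ (l + 2) =
      F * ((G₁ - G₂) * (G₁ - G₃) * (G₂ - G₃) * S) - E := by
    rw [← hW, hE, hR₁def, hR₂def, hR₃def]
    ring
  simp only [add_mul] at b12 b13 b23 hdn hlt
  by_cases hN : A₁ * (G₂ - G₃) - A₂ * (G₁ - G₃) + A₃ * (G₁ - G₂) = 0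
  · rw [hN, zero_mul, eq_comm, sub_eq_zero] at hid
    rw [hid] at hmain
    rw [hmain] at herr
    simp only [add_mul, mul_add, mul_assoc] at herr
    omega
  · have hl : ((A₁ * (G₂ - G₃) - A₂ * (G₁ - G₃) + A₃ * (G₁ - G₂)) *
        (G₁ * G₂ * G₃) ^ (l + 2)).natDegree =
        (A₁ * (G₂ - G₃) - A₂ * (G₁ - G₃) + A₃ * (G₁ - G₂)).natDegree
          + (l + 2) * (d + d + d) := by
      have hGG := hG₁.mul hG₂
      rw [natDegree_mul hN ((hGG.mul hG₃).pow _).ne_zero, (hGG.mul hG₃).natDegree_pow,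
        hGG.natDegree_mul hG₃, hG₁.natDegree_mul hG₂, hd₁, hd₂, hd₃]
    have hr := natDegree_sub_le (F * ((G₁ - G₂) * (G₁ - G₃) * (G₂ - G₃) * S)) E
    rw [← hid, hl, hmain] at hr
    have hr' := hr.trans (max_le_max_left _ herr)
    simp only [add_mul, mul_add, mul_assoc] at hr'
    omega

/-- **Proposition 5.3.** Suppose `p ∤ k(k+1)` and `h < d ≤ n/k`. If `G₁, G₂, G₃` are
three distinct polynomials of `S_q(d)`, then
`max_{i<j} deg(G_i − G_j) ≥ ((k+2)d − n)/3`. -/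
theorem triple_spacing_in_Sqd
    {Fq : Type} [Field Fq] [Fintype Fq] (q p k n h d : ℕ) [CharP Fq p]
    (hq : Fintype.card Fq = q) (hk : 2 ≤ k) (hp : ¬ p ∣ k * (k + 1))
    (F : Polynomial Fq) (hF : F.Monic) (hFdeg : F.natDegree = n)
    (hh0 : 0 < h) (hhn : h < n) (hhd : h < d) (hdn : (d : ℝ) ≤ (n : ℝ) / k)
    (G₁ G₂ G₃ : Polynomial Fq)
    (hG₁ : G₁.Monic ∧ G₁.natDegree = d ∧
      ∃ A : Polynomial Fq, A.Monic ∧ (F - G₁ ^ k * A).degree ≤ (h : WithBot ℕ))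
    (hG₂ : G₂.Monic ∧ G₂.natDegree = d ∧
      ∃ A : Polynomial Fq, A.Monic ∧ (F - G₂ ^ k * A).degree ≤ (h : WithBot ℕ))
    (hG₃ : G₃.Monic ∧ G₃.natDegree = d ∧
      ∃ A : Polynomial Fq, A.Monic ∧ (F - G₃ ^ k * A).degree ≤ (h : WithBot ℕ))
    (h12 : G₁ ≠ G₂) (h13 : G₁ ≠ G₃) (h23 : G₂ ≠ G₃) :
    (((k : ℝ) + 2) * d - n) / 3 ≤
      max (max ((((G₁ - G₂).natDegree : ℝ))) (((G₁ - G₃).natDegree : ℝ)))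
        (((G₂ - G₃).natDegree : ℝ)) := by
  obtain ⟨m₁, hd₁, A₁, -, hA₁⟩ := hG₁
  obtain ⟨m₂, hd₂, A₂, -, hA₂⟩ := hG₂
  obtain ⟨m₃, hd₃, A₃, -, hA₃⟩ := hG₃
  have hkK : (k : Fq) * (k + 1) ≠ 0 := by
    intro h0
    exact hp ((CharP.cast_eq_zero_iff Fq p _).1 (by push_cast; exact h0))
  have hkd : k * d ≤ n := by
    rw [le_div_iff₀ (by positivity)] at hdn
    rw [mul_comm]
    exact_mod_cast hdn
  have key := add_two_mul_le_add_three_mul_of_pow_mul_near hk hkK hhd hkd hF.ne_zero hFdeg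
    m₁ m₂ m₃ hd₁ hd₂ hd₃ (natDegree_le_of_degree_le hA₁) (natDegree_le_of_degree_le hA₂)
    (natDegree_le_of_degree_le hA₃) h12 h13 h23 rfl
  have key' : ((k : ℝ) + 2) * d ≤ n + 3 * (max (max (G₁ - G₂).natDegree (G₁ - G₃).natDegree)
      (G₂ - G₃).natDegree : ℕ) := by
    exact_mod_cast key
  rw [Nat.cast_max, Nat.cast_max] at key'
  linarith
end

section
/- Let F_q be a finite field with q elements of characteristic p, let k ≥ 3 with p ∤ k·C(2k−1, k−1), let F ∈ F_q[x] be monic of degree n, and let h, d be integers with n/(2k) ≤ h < d ≤ n/k. Let S_q(d) be the set of monic polynomials G of degree d such that G^k·A ∈ I_q(F,h) for some monic polynomial A. Then |S_q(d)| ≤ 2k·q^{(n−d)/(2k−1)}. -/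
open Polynomial

/-- The truncated binomial expansion `∑_{j<k} C(2k-1,j) (-y)^j x^(k-1-j)`. -/
def lowerBinom {R : Type*} [CommRing R] (k : ℕ) (x y : R) : R :=
  ∑ j ∈ Finset.range k, ((2 * k - 1).choose j : R) * (-y) ^ j * x ^ (k - 1 - j)

/-- The complementary part of the expansion of `(x - y)^(2k-1)`, divided by `-y^k`. -/
def upperBinom {R : Type*} [CommRing R] (k : ℕ) (x y : R) : R :=
  ∑ j ∈ Finset.range k,
    -(-1) ^ k * ((2 * k - 1).choose (k + j) : R) * (-y) ^ j * x ^ (k - 1 - j)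

theorem lowerBinom_mul_sub_upperBinom_mul {R : Type*} [CommRing R] {k : ℕ} (hk : 1 ≤ k)
    (x y : R) :
    lowerBinom k x y * x ^ k - upperBinom k x y * y ^ k = (x - y) ^ (2 * k - 1) := by
  have h1 : (x - y) ^ (2 * k - 1) = (-y + x) ^ (2 * k - 1) := by ring
  have h2 : 2 * k - 1 + 1 = k + k := by omega
  rw [h1, add_pow, h2, Finset.sum_range_add, lowerBinom, upperBinom, Finset.sum_mul,
    Finset.sum_mul, sub_eq_add_neg, ← Finset.sum_neg_distrib]
  congr 1
  · refine Finset.sum_congr rfl fun j hj => ?_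
    have hj' := Finset.mem_range.mp hj
    have : 2 * k - 1 - j = (k - 1 - j) + k := by omega
    rw [this, pow_add]
    ring
  · refine Finset.sum_congr rfl fun j hj => ?_
    have hj' := Finset.mem_range.mp hj
    have : 2 * k - 1 - (k + j) = k - 1 - j := by omega
    rw [this, pow_add, neg_pow y k]
    ring

theorem map_lowerBinom {R S : Type*} [CommRing R] [CommRing S] (f : R →+* S) (k : ℕ) (x y : R) :
    f (lowerBinom k x y) = lowerBinom k (f x) (f y) := by
  simp [lowerBinom]

theorem map_upperBinom {R S : Type*} [CommRing R] [CommRing S] (f : R →+* S) (k : ℕ) (x y : R) :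
    f (upperBinom k x y) = upperBinom k (f x) (f y) := by
  simp [upperBinom]

theorem lowerBinom_zero {R : Type*} [CommRing R] {k : ℕ} (hk : 1 ≤ k) (x : R) :
    lowerBinom k x 0 = x ^ (k - 1) := by
  rw [lowerBinom, Finset.sum_eq_single_of_mem 0 (Finset.mem_range.mpr hk)]
  · simp
  · intro j _ hj
    simp [hj]

theorem upperBinom_zero {R : Type*} [CommRing R] {k : ℕ} (hk : 1 ≤ k) (x : R) :
    upperBinom k x 0 = -(-1) ^ k * ((2 * k - 1).choose k : R) * x ^ (k - 1) := by
  rw [upperBinom, Finset.sum_eq_single_of_mem 0 (Finset.mem_range.mpr hk)]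
  · simp
  · intro j _ hj
    simp [hj]

theorem natDegree_lowerBinom_C_X_le {R : Type*} [CommRing R] (k : ℕ) (x : R) :
    (lowerBinom k (C x) X).natDegree ≤ k - 1 := by
  refine natDegree_sum_le_of_forall_le _ _ fun j hj => ?_
  have hj' := Finset.mem_range.mp hj
  rw [neg_pow, ← C_eq_natCast]
  compute_degree
  omega

theorem natDegree_upperBinom_C_X_le {R : Type*} [CommRing R] (k : ℕ) (x : R) :
    (upperBinom k (C x) X).natDegree ≤ k - 1 := by
  refine natDegree_sum_le_of_forall_le _ _ fun j hj => ?_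
  have hj' := Finset.mem_range.mp hj
  rw [neg_pow (X : R[X]), ← C_eq_natCast]
  compute_degree
  omega

theorem natDegree_upperBinom_le {R : Type*} [CommRing R] {k d : ℕ} {x y : R[X]}
    (hx : x.natDegree ≤ d) (hy : y.natDegree ≤ d) :
    (upperBinom k x y).natDegree ≤ (k - 1) * d := by
  refine natDegree_sum_le_of_forall_le _ _ fun j hj => ?_
  have hj' := Finset.mem_range.mp hj
  have h0 : (-(-1) ^ k * ((2 * k - 1).choose (k + j) : R[X])).natDegree ≤ 0 := by
    rw [← C_eq_natCast]
    compute_degree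
  have h1 : ((-y) ^ j).natDegree ≤ j * d := natDegree_pow_le_of_le j (by rwa [natDegree_neg])
  have h2 : (x ^ (k - 1 - j)).natDegree ≤ (k - 1 - j) * d := natDegree_pow_le_of_le _ hx
  refine (natDegree_mul_le_of_le (natDegree_mul_le_of_le h0 h1) h2).trans ?_
  rw [zero_add, ← add_mul]
  exact Nat.mul_le_mul_right d (by omega)

/-- If `x^k a` and `y^k b` are close and `x`, `y` are close, then `a / b` is given exactly by a
Padé approximant of `(y / x)^k`. -/
theorem lowerBinom_mul_eq_upperBinom_mul {K : Type*} [Field K] {k d h m r : ℕ} (hk : 1 ≤ k)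
    (hhd : h < d) (hr : m + (2 * k - 1) * r < k * d) {x y a b : K[X]} (hx : x.Monic)
    (hxd : x.natDegree = d) (hyd : y.natDegree = d) (hb : b.natDegree ≤ m)
    (hxy : (x - y).natDegree ≤ r) (hE : (x ^ k * a - y ^ k * b).natDegree ≤ h) :
    lowerBinom k x y * b = upperBinom k x y * a := by
  by_contra hne
  have hD : lowerBinom k x y * b - upperBinom k x y * a ≠ 0 := sub_ne_zero.mpr hne
  have key : x ^ k * (lowerBinom k x y * b - upperBinom k x y * a) =
      b * (x - y) ^ (2 * k - 1) - upperBinom k x y * (x ^ k * a - y ^ k * b) := by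
    rw [← lowerBinom_mul_sub_upperBinom_mul hk]
    ring
  have hl : k * d ≤ (x ^ k * (lowerBinom k x y * b - upperBinom k x y * a)).natDegree := by
    rw [(hx.pow k).natDegree_mul' hD, hx.natDegree_pow, hxd]
    exact Nat.le_add_right _ _
  have h1 : (b * (x - y) ^ (2 * k - 1)).natDegree ≤ m + (2 * k - 1) * r :=
    natDegree_mul_le_of_le hb (natDegree_pow_le_of_le _ hxy)
  have h2 : (upperBinom k x y * (x ^ k * a - y ^ k * b)).natDegree ≤ (k - 1) * d + h :=
    natDegree_mul_le_of_le (natDegree_upperBinom_le hxd.le hyd.le) hE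
  have h3 : (k - 1) * d + h < k * d := by
    obtain ⟨j, rfl⟩ : ∃ j, k = j + 1 := ⟨k - 1, by omega⟩
    rw [add_tsub_cancel_right, add_mul]
    omega
  rw [key] at hl
  have := natDegree_sub_le (b * (x - y) ^ (2 * k - 1))
    (upperBinom k x y * (x ^ k * a - y ^ k * b))
  omega

theorem natDegree_le_natDegree_pow_mul_sub_pow_mul {K : Type*} [Field K] {k d : ℕ} (hk : 2 ≤ k)
    (hkK : (k : K) ≠ 0) {x y a : K[X]} (hx : x.Monic) (hy : y.Monic) (hxd : x.natDegree = d)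
    (hyd : y.natDegree = d) (hxy : x ≠ y) (ha : a ≠ 0) :
    d ≤ (x ^ k * a - y ^ k * a).natDegree := by
  have hcoeff : (∑ i ∈ Finset.range k, x ^ i * y ^ (k - 1 - i)).coeff ((k - 1) * d) = k := by
    rw [finsetSum_coeff, Finset.sum_congr rfl (g := fun _ => (1 : K))]
    · simp
    · intro i hi
      have hi' := Finset.mem_range.mp hi
      have hm : (x ^ i * y ^ (k - 1 - i)).Monic := (hx.pow i).mul (hy.pow _)
      have hd : (x ^ i * y ^ (k - 1 - i)).natDegree = (k - 1) * d := by
        rw [(hx.pow i).natDegree_mul (hy.pow _), hx.natDegree_pow, hy.natDegree_pow, hxd, hyd,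
          ← add_mul]
        congr 1
        omega
      rw [← hd]
      exact hm.coeff_natDegree
  have hs : (∑ i ∈ Finset.range k, x ^ i * y ^ (k - 1 - i)) ≠ 0 := by
    intro h0
    rw [h0, coeff_zero] at hcoeff
    exact hkK hcoeff.symm
  have hsd := le_natDegree_of_ne_zero (hcoeff.trans_ne hkK)
  rw [← sub_mul, ← (Commute.all x y).mul_geom_sum₂,
    natDegree_mul (mul_ne_zero (sub_ne_zero.mpr hxy) hs) ha,
    natDegree_mul (sub_ne_zero.mpr hxy) hs]
  have : 1 * d ≤ (k - 1) * d := Nat.mul_le_mul_right d (by omega)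
  omega

/-- A set of polynomials in a short interval, each having a cofactor that makes the products
`G^k A` close to each other, has at most `2k` elements. -/
theorem card_le_two_mul_of_close {K : Type*} [Field K] {k d h m r : ℕ} (hk : 2 ≤ k)
    (hkK : (k : K) ≠ 0) (hchoose : ((2 * k - 1).choose k : K) ≠ 0)
    (hhd : h < d) (hr : m + (2 * k - 1) * r < k * d) (T : Finset K[X]) (A : K[X] → K[X])
    (hmonic : ∀ G ∈ T, G.Monic) (hdeg : ∀ G ∈ T, G.natDegree = d)
    (hA0 : ∀ G ∈ T, A G ≠ 0) (hA : ∀ G ∈ T, (A G).natDegree ≤ m)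
    (hclose : ∀ G₁ ∈ T, ∀ G₂ ∈ T, (G₁ - G₂).natDegree ≤ r)
    (hE : ∀ G₁ ∈ T, ∀ G₂ ∈ T, (G₁ ^ k * A G₁ - G₂ ^ k * A G₂).natDegree ≤ h) :
    T.card ≤ 2 * k := by
  classical
  have hk1 : 1 ≤ k := by omega
  by_cases hT : T.card ≤ 1
  · omega
  obtain ⟨x, hx, y, hy, hxy⟩ := Finset.one_lt_card.mp (not_le.mp hT)
  have hAxy : A x ≠ A y := by
    intro heq
    have h1 := hE x hx y hy
    rw [← heq] at h1
    have h2 := natDegree_le_natDegree_pow_mul_sub_pow_mul hk hkK (hmonic x hx) (hmonic y hy)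
      (hdeg x hx) (hdeg y hy) hxy (hA0 x hx)
    omega
  set H : K[X][X] := lowerBinom k (C x) X * upperBinom k (C y) X * C (A y) -
    lowerBinom k (C y) X * upperBinom k (C x) X * C (A x) with hH
  have heval : ∀ z : K[X], H.eval z = lowerBinom k x z * upperBinom k y z * A y -
      lowerBinom k y z * upperBinom k x z * A x := by
    intro z
    have h1 (w : K[X]) : (lowerBinom k (C w) X).eval z = lowerBinom k w z := by
      simpa using map_lowerBinom (evalRingHom z) k (C w) X
    have h2 (w : K[X]) : (upperBinom k (C w) X).eval z = upperBinom k w z := by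
      simpa using map_upperBinom (evalRingHom z) k (C w) X
    simp only [hH, eval_sub, eval_mul, eval_C, h1, h2]
  have hH0 : H ≠ 0 := by
    intro h0
    have h1 := heval 0
    rw [h0, eval_zero, lowerBinom_zero hk1, lowerBinom_zero hk1, upperBinom_zero hk1,
      upperBinom_zero hk1] at h1
    have h2 : ((2 * k - 1).choose k : K[X]) ≠ 0 := by
      rw [← C_eq_natCast]
      exact C_ne_zero.mpr hchoose
    have h3 : -(-1) ^ k * ((2 * k - 1).choose k : K[X]) * x ^ (k - 1) * y ^ (k - 1) *
        (A y - A x) ≠ 0 :=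
      mul_ne_zero (mul_ne_zero (mul_ne_zero (mul_ne_zero
        (neg_ne_zero.mpr (pow_ne_zero _ (neg_ne_zero.mpr one_ne_zero))) h2)
        (pow_ne_zero _ (hmonic x hx).ne_zero)) (pow_ne_zero _ (hmonic y hy).ne_zero))
        (sub_ne_zero.mpr hAxy.symm)
    exact h3 (by linear_combination -h1)
  have hHd : H.natDegree ≤ 2 * k - 2 := by
    have hb (u v : K[X]) (w : K[X]) :
        (lowerBinom k (C u) X * upperBinom k (C v) X * C w).natDegree ≤ 2 * k - 2 := by
      refine (natDegree_mul_le_of_le (natDegree_mul_le_of_le (natDegree_lowerBinom_C_X_le k u)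
        (natDegree_upperBinom_C_X_le k v)) (natDegree_C w).le).trans ?_
      omega
    exact (natDegree_sub_le_of_le (hb _ _ _) (hb _ _ _)).trans (max_self _).le
  have hsub : T ⊆ insert x (insert y H.roots.toFinset) := by
    intro z hz
    rw [Finset.mem_insert, Finset.mem_insert, Multiset.mem_toFinset, mem_roots hH0]
    refine Or.inr (Or.inr ?_)
    have hpade (w : K[X]) (hw : w ∈ T) :=
      lowerBinom_mul_eq_upperBinom_mul hk1 hhd hr (hmonic w hw) (hdeg w hw) (hdeg z hz) (hA z hz)
        (hclose w hw z hz) (hE w hw z hz)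
    have h1 := hpade x hx
    have h2 := hpade y hy
    rw [IsRoot.def, heval]
    refine mul_right_cancel₀ (hA0 z hz) ?_
    linear_combination upperBinom k y z * A y * h1 - upperBinom k x z * A x * h2
  have hc := Finset.card_le_card hsub
  have h1 := Finset.card_insert_le x (insert y H.roots.toFinset)
  have h2 := Finset.card_insert_le y H.roots.toFinset
  have h3 := H.roots.toFinset_card_le
  have h4 := H.card_roots'
  omega

theorem natDegree_sub_le_of_coeff_eq {R : Type*} [Ring R] {d e : ℕ} {x y : R[X]}
    (he : e < d) (hx : x.Monic) (hy : y.Monic) (hxd : x.natDegree = d) (hyd : y.natDegree = d)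
    (hcoeff : ∀ i : Fin e, x.coeff (d - e + i) = y.coeff (d - e + i)) :
    (x - y).natDegree ≤ d - e - 1 := by
  rw [natDegree_le_iff_coeff_eq_zero]
  intro N hN
  rw [coeff_sub, sub_eq_zero]
  rcases lt_trichotomy N d with h | h | h
  · have := hcoeff ⟨N - (d - e), by omega⟩
    simpa [show d - e + (N - (d - e)) = N by omega] using this
  · subst h
    rw [← hxd, hx.coeff_natDegree, hxd, ← hyd, hy.coeff_natDegree]
  · rw [coeff_eq_zero_of_natDegree_lt (by omega), coeff_eq_zero_of_natDegree_lt (by omega)]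

/-- **Proposition A.1 (Halberstam–Roth method).** Let `k ≥ 3` with
`p ∤ k·C(2k−1,k−1)`. If `n/(2k) ≤ h < d ≤ n/k`, then
`|S_q(d)| ≤ 2k·q^{(n−d)/(2k−1)}`. -/
theorem card_Sqd_halberstam_roth
    {Fq : Type} [Field Fq] [Fintype Fq] (q p k n h d : ℕ) [CharP Fq p]
    (hq : Fintype.card Fq = q) (hk : 3 ≤ k)
    (hp : ¬ p ∣ k * Nat.choose (2 * k - 1) (k - 1))
    (F : Polynomial Fq) (hF : F.Monic) (hFdeg : F.natDegree = n)
    (hh1 : (n : ℝ) / (2 * k) ≤ (h : ℝ)) (hhd : h < d) (hdn : (d : ℝ) ≤ (n : ℝ) / k) :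
    ({G : Polynomial Fq | G.Monic ∧ G.natDegree = d ∧
        ∃ A : Polynomial Fq, A.Monic ∧
          (F - G ^ k * A).degree ≤ (h : WithBot ℕ)}.ncard : ℝ)
      ≤ 2 * k * (q : ℝ) ^ (((n : ℝ) - d) / (2 * (k : ℝ) - 1)) := by
  classical
  set S := {G : Polynomial Fq | G.Monic ∧ G.natDegree = d ∧
        ∃ A : Polynomial Fq, A.Monic ∧ (F - G ^ k * A).degree ≤ (h : WithBot ℕ)} with hS
  by_cases hfin : S.Finite
  swap
  · rw [Set.Infinite.ncard hfin, Nat.cast_zero]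
    positivity
  have hk0 : (0 : ℝ) < k := by exact_mod_cast (by omega : 0 < k)
  have hn1 : n ≤ 2 * k * h := by
    rw [div_le_iff₀ (by positivity)] at hh1
    have : (n : ℝ) ≤ ((2 * k * h : ℕ) : ℝ) := by push_cast; linarith
    exact_mod_cast this
  have hn2 : k * d ≤ n := by
    rw [le_div_iff₀ hk0] at hdn
    have : ((k * d : ℕ) : ℝ) ≤ n := by push_cast; linarith
    exact_mod_cast this
  have hdle : d ≤ n := le_trans (Nat.le_mul_of_pos_left d (by omega)) hn2
  have hcast : ((k * (2 * k - 1).choose k : ℕ) : Fq) ≠ 0 := by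
    rw [Ne, CharP.cast_eq_zero_iff Fq p]
    rwa [← Nat.choose_symm_of_eq_add (show 2 * k - 1 = (k - 1) + k by omega)]
  rw [Nat.cast_mul] at hcast
  have hkK := left_ne_zero_of_mul hcast
  have hchoose := right_ne_zero_of_mul hcast
  set e := (n - d) / (2 * k - 1) with he
  have hpos : 0 < 2 * k - 1 := by omega
  have hnlt : n < 2 * k * d :=
    hn1.trans_lt (Nat.mul_lt_mul_of_pos_left hhd (by omega))
  have hsplit : (2 * k - 1) * d + d = 2 * k * d := by
    rw [← Nat.succ_mul]
    congr 1
    omega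
  have hed : e < d := by
    rw [he, Nat.div_lt_iff_lt_mul hpos, mul_comm]
    omega
  have hr : (n - k * d) + (2 * k - 1) * (d - e - 1) < k * d := by
    have h1 : n - d < (2 * k - 1) * (e + 1) := by
      simpa [mul_comm, he, mul_add] using Nat.lt_mul_div_succ (n - d) hpos
    have h2 : (2 * k - 1) * (d - e - 1) + (2 * k - 1) * (e + 1) = (2 * k - 1) * d := by
      rw [← mul_add]
      congr 1
      omega
    have h3 : 2 * k * d = k * d + k * d := by ring
    omega
  have hex : ∀ G : Fq[X], ∃ A : Fq[X], G ∈ S → A.Monic ∧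
      (F - G ^ k * A).degree ≤ (h : WithBot ℕ) := by
    intro G
    by_cases hG : G ∈ S
    · obtain ⟨A, hA⟩ := hG.2.2
      exact ⟨A, fun _ => hA⟩
    · exact ⟨0, fun h' => absurd h' hG⟩
  choose A hA using hex
  have hR : ∀ G ∈ S, (F - G ^ k * A G).natDegree ≤ h := fun G hG =>
    natDegree_le_iff_degree_le.mpr (hA G hG).2
  have hAdeg : ∀ G ∈ S, (A G).natDegree ≤ n - k * d := by
    intro G hG
    have h1 := natDegree_sub_eq_left_of_natDegree_lt
      (show (F - G ^ k * A G).natDegree < F.natDegree by have := hR G hG; omega)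
    rw [sub_sub_cancel, (hG.1.pow k).natDegree_mul (hA G hG).1, hG.1.natDegree_pow, hG.2.1] at h1
    omega
  have hcard : hfin.toFinset.card ≤ 2 * k * q ^ e := by
    have h1 := Finset.card_le_mul_card_image_of_maps_to (s := hfin.toFinset)
      (t := (Finset.univ : Finset (Fin e → Fq)))
      (f := fun G => fun i : Fin e => G.coeff (d - e + i)) (fun _ _ => Finset.mem_univ _) (2 * k) ?_
    · simpa [hq] using h1
    intro c _
    have hmem : ∀ G ∈ hfin.toFinset.filter
        (fun G => (fun i : Fin e => G.coeff (d - e + i)) = c),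
        G ∈ S ∧ (fun i : Fin e => G.coeff (d - e + i)) = c := by
      intro G hG
      simpa using hG
    refine card_le_two_mul_of_close (by omega) hkK hchoose hhd hr _ A
      (fun G hG => (hmem G hG).1.1) (fun G hG => (hmem G hG).1.2.1)
      (fun G hG => (hA G (hmem G hG).1).1.ne_zero) (fun G hG => hAdeg G (hmem G hG).1) ?_ ?_
    · intro G₁ h₁ G₂ h₂
      have m₁ := hmem G₁ h₁
      have m₂ := hmem G₂ h₂
      exact natDegree_sub_le_of_coeff_eq hed m₁.1.1 m₂.1.1 m₁.1.2.1 m₂.1.2.1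
        fun i => congrFun (m₁.2.trans m₂.2.symm) i
    · intro G₁ h₁ G₂ h₂
      rw [← sub_sub_sub_cancel_left _ _ F]
      exact (natDegree_sub_le_of_le (hR G₂ (hmem G₂ h₂).1) (hR G₁ (hmem G₁ h₁).1)).trans
        (max_self h).le
  rw [Set.ncard_eq_toFinset_card S hfin]
  have hq1 : (1 : ℝ) ≤ q := by
    rw [← hq]
    exact_mod_cast Fintype.card_pos
  calc (hfin.toFinset.card : ℝ) ≤ 2 * k * (q : ℝ) ^ e := by exact_mod_cast hcard
    _ = 2 * k * (q : ℝ) ^ (e : ℝ) := by rw [Real.rpow_natCast]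
    _ ≤ _ := by
      gcongr
      have h1 : ((2 * k - 1 : ℕ) : ℝ) = 2 * (k : ℝ) - 1 := by
        rw [Nat.cast_sub (by omega)]
        push_cast
        ring
      rw [← h1, ← Nat.cast_sub hdle]
      exact Nat.cast_div_le
end

section
/- Let F_q be a finite field with q elements of characteristic p, let k ≥ 2 with p ∤ k, let F ∈ F_q[x] be monic of degree n, and let h, d be integers with 0 < h < d ≤ n/k and d > n/(k+1). Let S_q(d) be the set of monic polynomials G of degree d such that G^k·A ∈ I_q(F,h) for some monic polynomial A. Then |S_q(d)| ≤ q^{n − k·d}. -/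
open Polynomial

/-- If `k` is nonzero in a field `K`, distinct monic polynomials `G₁`, `G₂` of degree `d` have
`k`-th powers whose difference has degree at least `d * (k - 1)`. -/
theorem le_degree_pow_sub_pow {K : Type*} [Field K] {k d : ℕ} (hk : (k : K) ≠ 0)
    {G₁ G₂ : K[X]} (h₁ : G₁.Monic) (h₂ : G₂.Monic) (hd₁ : G₁.natDegree = d)
    (hd₂ : G₂.natDegree = d) (hne : G₁ ≠ G₂) :
    ((d * (k - 1) : ℕ) : WithBot ℕ) ≤ (G₁ ^ k - G₂ ^ k).degree := by
  set S : K[X] := ∑ i ∈ Finset.range k, G₁ ^ i * G₂ ^ (k - 1 - i) with hS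
  have hcoeff : S.coeff (d * (k - 1)) = (k : K) := by
    rw [hS, finsetSum_coeff]
    trans ∑ i ∈ Finset.range k, (1 : K)
    · refine Finset.sum_congr rfl fun i hi => ?_
      have hm : (G₁ ^ i * G₂ ^ (k - 1 - i)).Monic := (h₁.pow i).mul (h₂.pow _)
      have hdeg : (G₁ ^ i * G₂ ^ (k - 1 - i)).natDegree = d * (k - 1) := by
        rw [(h₁.pow i).natDegree_mul (h₂.pow _), h₁.natDegree_pow, h₂.natDegree_pow, hd₁, hd₂,
          ← add_mul, mul_comm]
        congr 1
        have := Finset.mem_range.1 hi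
        omega
      rw [← hdeg]
      exact hm.coeff_natDegree
    · simp
  have hSdeg : ((d * (k - 1) : ℕ) : WithBot ℕ) ≤ S.degree :=
    le_degree_of_ne_zero (by rwa [hcoeff])
  rw [← (Commute.all G₁ G₂).geom_sum₂_mul k, degree_mul]
  exact hSdeg.trans (le_add_of_nonneg_right (zero_le_degree_iff.2 (sub_ne_zero.2 hne)))

/-- A set of polynomials that injects into the monic polynomials of degree `a` has at most
`q ^ a` elements. -/
theorem ncard_le_of_injOn_monic {K α : Type*} [Field K] [Fintype K] {s : Set α} {a : ℕ}
    (f : α → K[X]) (hf : Set.InjOn f s) (hm : ∀ x ∈ s, (f x).Monic)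
    (hd : ∀ x ∈ s, (f x).natDegree = a) : s.ncard ≤ Fintype.card K ^ a := by
  have hinj : Function.Injective fun (x : s) (i : Fin a) => (f x).coeff i := by
    rintro ⟨x, hx⟩ ⟨y, hy⟩ hxy
    refine Subtype.ext (hf hx hy (ext fun i => ?_))
    rcases lt_trichotomy i a with hi | rfl | hi
    · exact congrFun hxy ⟨i, hi⟩
    · have hx' := (hm x hx).coeff_natDegree
      have hy' := (hm y hy).coeff_natDegree
      rw [hd x hx] at hx'
      rw [hd y hy] at hy'
      rw [hx', hy']
    · rw [coeff_eq_zero_of_natDegree_lt (by rwa [hd x hx]),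
        coeff_eq_zero_of_natDegree_lt (by rwa [hd y hy])]
  simpa [Nat.card_eq_fintype_card] using Nat.card_le_card_of_injective _ hinj

/-- **Bound (2.8).** Let `k ≥ 2` with `p ∤ k`. If `0 < h < d ≤ n/k` and `d > n/(k+1)`,
then `|S_q(d)| ≤ q^{n − kd}`. -/
theorem card_Sqd_basic_bound
    {Fq : Type} [Field Fq] [Fintype Fq] (q p k n h d : ℕ) [CharP Fq p]
    (hq : Fintype.card Fq = q) (hk : 2 ≤ k) (hp : ¬ p ∣ k)
    (F : Polynomial Fq) (hF : F.Monic) (hFdeg : F.natDegree = n)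
    (hh0 : 0 < h) (hhd : h < d) (hdn : (d : ℝ) ≤ (n : ℝ) / k)
    (hd2 : (n : ℝ) / ((k : ℝ) + 1) < (d : ℝ)) :
    ({G : Polynomial Fq | G.Monic ∧ G.natDegree = d ∧
        ∃ A : Polynomial Fq, A.Monic ∧
          (F - G ^ k * A).degree ≤ (h : WithBot ℕ)}.ncard : ℝ)
      ≤ (q : ℝ) ^ ((n : ℝ) - k * d) := by
  have hkd : k * d ≤ n := by
    rw [le_div_iff₀ (by positivity)] at hdn
    rw [mul_comm]
    exact_mod_cast hdn
  have hk0 : (k : Fq) ≠ 0 := fun h0 => hp ((CharP.cast_eq_zero_iff Fq p k).1 h0)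
  have hhn : h < n := by nlinarith
  rw [← Nat.cast_mul, ← Nat.cast_sub hkd, Real.rpow_natCast]
  set s := {G : Polynomial Fq | G.Monic ∧ G.natDegree = d ∧
        ∃ A : Polynomial Fq, A.Monic ∧ (F - G ^ k * A).degree ≤ (h : WithBot ℕ)}
  have hex : ∀ G, ∃ A : Polynomial Fq, G ∈ s →
      A.Monic ∧ (F - G ^ k * A).degree ≤ (h : WithBot ℕ) := by
    intro G
    by_cases hG : G ∈ s
    · obtain ⟨A, hA⟩ := hG.2.2
      exact ⟨A, fun _ => hA⟩
    · exact ⟨0, fun h' => absurd h' hG⟩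
  choose f hf using hex
  have key : s.ncard ≤ Fintype.card Fq ^ (n - k * d) := by
    refine ncard_le_of_injOn_monic f ?_ (fun G hG => (hf G hG).1) ?_
    · intro G₁ hG₁ G₂ hG₂ heq
      by_contra hne
      have hlow := le_degree_pow_sub_pow hk0 hG₁.1 hG₂.1 hG₁.2.1 hG₂.2.1 hne
      have h₁ := (hf G₁ hG₁).2
      obtain ⟨hA, h₂⟩ := hf G₂ hG₂
      rw [heq] at h₁
      have hup : ((G₁ ^ k - G₂ ^ k) * f G₂).degree ≤ (h : WithBot ℕ) := by
        have : (G₁ ^ k - G₂ ^ k) * f G₂ = (F - G₂ ^ k * f G₂) - (F - G₁ ^ k * f G₂) := by ring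
        rw [this]
        exact (degree_sub_le _ _).trans (max_le h₂ h₁)
      rw [degree_mul] at hup
      have hle := (hlow.trans
        (le_add_of_nonneg_right (zero_le_degree_iff.2 hA.ne_zero))).trans hup
      have hle' : d * (k - 1) ≤ h := by exact_mod_cast hle
      have : d * 1 ≤ d * (k - 1) := Nat.mul_le_mul_left d (by omega)
      omega
    · intro G hG
      obtain ⟨hA, hdeg⟩ := hf G hG
      have hlt : (F - G ^ k * f G).degree < F.degree := by
        rw [degree_eq_natDegree hF.ne_zero, hFdeg]
        exact hdeg.trans_lt (by exact_mod_cast hhn)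
      have hnat : (G ^ k * f G).natDegree = n := by
        rw [← hFdeg]
        refine natDegree_eq_of_degree_eq ?_
        have := degree_sub_eq_left_of_degree_lt hlt
        rwa [sub_sub_cancel] at this
      rw [(hG.1.pow k).natDegree_mul hA, hG.1.natDegree_pow, hG.2.1] at hnat
      omega
  rw [← hq]
  exact_mod_cast key
end

section
/- Let F_q be a finite field with q elements of characteristic p, let F ∈ F_q[x] be monic of degree n, and let h be an integer with 0 < h < n. Then the number of polynomials G ∈ I_q(F,h) such that P^2 divides G for some irreducible polynomial P with deg P > h is at most (n/(h+1))·q^{h − ⌊h/p⌋} + q^{⌊h/p⌋ + 1}. -/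
open Polynomial

/-- The elements of a short interval are determined by their coefficients of index at most `h`. -/
theorem eq_of_degree_sub_le_of_coeff_eq {R : Type*} [Ring R] {F G₁ G₂ : R[X]} {h : ℕ}
    (h₁ : (F - G₁).degree ≤ h) (h₂ : (F - G₂).degree ≤ h)
    (hc : ∀ m ≤ h, G₁.coeff m = G₂.coeff m) : G₁ = G₂ := by
  ext m
  rcases le_or_gt m h with hm | hm
  · exact hc m hm
  · have e₁ := (degree_le_iff_coeff_zero _ _).1 h₁ m (by exact_mod_cast hm)
    have e₂ := (degree_le_iff_coeff_zero _ _).1 h₂ m (by exact_mod_cast hm)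
    rw [coeff_sub, sub_eq_zero] at e₁ e₂
    exact e₁.symm.trans e₂

theorem finite_setOf_degree_sub_le {R : Type*} [Ring R] [Finite R] (F : R[X]) (h : ℕ) :
    {G : R[X] | (F - G).degree ≤ h}.Finite := by
  refine Set.Finite.of_finite_image (f := fun G (i : Fin (h + 1)) => G.coeff i)
    (Set.toFinite _) fun G₁ h₁ G₂ h₂ he => ?_
  exact eq_of_degree_sub_le_of_coeff_eq h₁ h₂ fun m hm => congrFun he ⟨m, by lia⟩

/-- A divisor of two elements of a short interval is either short or forces them to agree. -/
theorem eq_of_degree_sub_le_of_dvd {K : Type*} [Field K] {F G₁ G₂ P : K[X]} {h : ℕ}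
    (h₁ : (F - G₁).degree ≤ h) (h₂ : (F - G₂).degree ≤ h) (hP : h < P.natDegree)
    (d₁ : P ∣ G₁) (d₂ : P ∣ G₂) : G₁ = G₂ := by
  rw [← sub_eq_zero]
  refine eq_zero_of_dvd_of_degree_lt (dvd_sub d₁ d₂) ?_
  have e : G₁ - G₂ = (F - G₂) - (F - G₁) := by ring
  rw [e]
  refine ((degree_sub_le _ _).trans (max_le h₂ h₁)).trans_lt ?_
  rw [degree_eq_natDegree (ne_zero_of_natDegree_gt hP)]
  exact_mod_cast hP

/-- At most `natDegree D / (h + 1)` elements of a short interval share an irreducible factor of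
degree larger than `h` with a fixed nonzero polynomial `D`. -/
theorem card_mul_le_natDegree_of_irreducible_dvd {K : Type*} [Field K] {F D : K[X]} {h : ℕ}
    (hD : D ≠ 0) (A : Finset K[X])
    (hA : ∀ G ∈ A, (F - G).degree ≤ h ∧
      ∃ P : K[X], Irreducible P ∧ h < P.natDegree ∧ P ∣ G ∧ P ∣ D) :
    A.card * (h + 1) ≤ D.natDegree := by
  choose! hI P hirr hdeg hdG hdD using hA
  have hdvd : ∏ G ∈ A, P G ∣ D := by
    refine Finset.prod_dvd_of_coprime (fun G₁ h₁ G₂ h₂ hne => ?_) hdD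
    refine (hirr G₁ h₁).coprime_iff_not_dvd.2 fun hd => hne ?_
    exact eq_of_degree_sub_le_of_dvd (hI _ h₁) (hI _ h₂) (hdeg _ h₁) (hdG _ h₁)
      (hd.trans (hdG _ h₂))
  calc A.card * (h + 1) ≤ ∑ G ∈ A, (P G).natDegree :=
        A.card_nsmul_le_sum (fun G => (P G).natDegree) (h + 1) hdeg
    _ = (∏ G ∈ A, P G).natDegree :=
        (natDegree_prod _ _ fun G hG => (hirr G hG).ne_zero).symm
    _ ≤ D.natDegree := natDegree_le_of_dvd hdvd hD

theorem coeff_eq_of_derivative_eq {K : Type*} [Field K] (p : ℕ) [CharP K p] {G₁ G₂ : K[X]}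
    (hd : derivative G₁ = derivative G₂) {m : ℕ} (hm : ¬ p ∣ m) :
    G₁.coeff m = G₂.coeff m := by
  obtain ⟨k, rfl⟩ := Nat.exists_eq_succ_of_ne_zero (fun h0 : m = 0 => hm (h0 ▸ dvd_zero p))
  have e := congrArg (fun G => G.coeff k) hd
  simp only [coeff_derivative] at e
  have hk : ((k : K) + 1) ≠ 0 := by
    have := mt (CharP.cast_eq_zero_iff K p (k + 1)).1 hm
    exact_mod_cast this
  exact mul_right_cancel₀ hk e

/-- In characteristic `p`, the derivative of an element of a short interval is determined by the
coefficients of index prime to `p` and at most `h`. -/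
theorem derivative_eq_of_degree_sub_le {K : Type*} [Field K] (p : ℕ) [CharP K p]
    {F G₁ G₂ : K[X]} {h : ℕ}
    (h₁ : (F - G₁).degree ≤ h) (h₂ : (F - G₂).degree ≤ h)
    (hc : ∀ m ≤ h, ¬ p ∣ m → G₁.coeff m = G₂.coeff m) : derivative G₁ = derivative G₂ := by
  ext k
  rw [coeff_derivative, coeff_derivative]
  by_cases hp : p ∣ k + 1
  · have : ((k : K) + 1) = 0 := by
      exact_mod_cast (CharP.cast_eq_zero_iff K p (k + 1)).2 hp
    simp [this]
  congr 1
  rcases le_or_gt (k + 1) h with hm | hm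
  · exact hc _ hm hp
  · have e₁ := (degree_le_iff_coeff_zero _ _).1 h₁ (k + 1) (by exact_mod_cast hm)
    have e₂ := (degree_le_iff_coeff_zero _ _).1 h₂ (k + 1) (by exact_mod_cast hm)
    rw [coeff_sub, sub_eq_zero] at e₁ e₂
    exact e₁.symm.trans e₂

/-- A short interval over a finite field contains few polynomials with a given derivative. -/
theorem card_le_of_derivative_eq {K : Type*} [Field K] [Fintype K] (p : ℕ) [CharP K p]
    {F D : K[X]} {h : ℕ} (A : Finset K[X])
    (hA : ∀ G ∈ A, (F - G).degree ≤ h ∧ derivative G = D) :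
    A.card ≤ Fintype.card K ^ (h / p + 1) := by
  have hp : 0 < p := (CharP.char_is_prime K p).pos
  have hcard : (Finset.univ : Finset (Fin (h / p + 1) → K)).card =
      Fintype.card K ^ (h / p + 1) := by
    rw [Finset.card_univ, Fintype.card_fun, Fintype.card_fin]
  rw [← hcard]
  refine Finset.card_le_card_of_injOn
    (fun G (i : Fin (h / p + 1)) => G.coeff (p * i)) (by simp) fun G₁ h₁ G₂ h₂ he => ?_
  obtain ⟨i₁, d₁⟩ := hA _ h₁
  obtain ⟨i₂, d₂⟩ := hA _ h₂
  refine eq_of_degree_sub_le_of_coeff_eq i₁ i₂ fun m hm => ?_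
  by_cases hpm : p ∣ m
  · obtain ⟨i, rfl⟩ := hpm
    have hi : i ≤ h / p := (Nat.le_div_iff_mul_le hp).2 (by rwa [mul_comm])
    exact congrFun he ⟨i, by lia⟩
  · exact coeff_eq_of_derivative_eq p (d₁.trans d₂.symm) hpm

theorem card_filter_not_dvd_Ioc (h p : ℕ) :
    ((Finset.Ioc 0 h).filter fun m => ¬ p ∣ m).card = h - h / p := by
  have e := Finset.card_filter_add_card_filter_not (s := Finset.Ioc 0 h) (fun m => p ∣ m)
  rw [Nat.Ioc_filter_dvd_card_eq_div, Nat.card_Ioc] at e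
  lia

/-- Few elements of a short interval with nonzero derivative have a repeated irreducible factor
of degree larger than `h`. -/
theorem card_le_of_sq_dvd_of_derivative_ne_zero {K : Type*} [Field K] [Fintype K] (p : ℕ)
    [CharP K p] {F : K[X]} {h : ℕ} (hF : h ≤ F.natDegree) (A : Finset K[X])
    (hA : ∀ G ∈ A, (F - G).degree ≤ h ∧ derivative G ≠ 0 ∧
      ∃ P : K[X], Irreducible P ∧ h < P.natDegree ∧ P ^ 2 ∣ G) :
    A.card ≤ F.natDegree / (h + 1) * Fintype.card K ^ (h - h / p) := by
  classical
  let T := (Finset.Ioc 0 h).filter fun m => ¬ p ∣ m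
  have hcard : (Finset.univ : Finset (T → K)).card = Fintype.card K ^ (h - h / p) := by
    rw [Finset.card_univ, Fintype.card_fun, Fintype.card_coe, card_filter_not_dvd_Ioc]
  rw [← hcard]
  refine Finset.card_le_mul_card_image_of_maps_to (f := fun G (i : T) => G.coeff i)
    (fun _ _ => Finset.mem_univ _) _ fun c _ => ?_
  rw [Nat.le_div_iff_mul_le h.succ_pos]
  rcases Finset.eq_empty_or_nonempty (A.filter fun G => (fun i : T => G.coeff i) = c)
    with he | ⟨G₀, hG₀⟩
  · simp [he]
  obtain ⟨hG₀A, hG₀c⟩ := Finset.mem_filter.1 hG₀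
  obtain ⟨hI₀, hD₀, -⟩ := hA G₀ hG₀A
  refine (card_mul_le_natDegree_of_irreducible_dvd (F := F) hD₀ _ fun G hG => ?_).trans ?_
  · obtain ⟨hGA, hGc⟩ := Finset.mem_filter.1 hG
    obtain ⟨hI, -, P, hirr, hdeg, hdvd⟩ := hA G hGA
    refine ⟨hI, P, hirr, hdeg, (dvd_pow_self P two_ne_zero).trans hdvd, ?_⟩
    have hder : derivative G = derivative G₀ := by
      refine derivative_eq_of_degree_sub_le p hI hI₀ fun m hm hpm => ?_
      have hmT : m ∈ T := by
        refine Finset.mem_filter.2 ⟨Finset.mem_Ioc.2 ⟨?_, hm⟩, hpm⟩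
        exact Nat.pos_of_ne_zero fun h0 => hpm (h0 ▸ dvd_zero p)
      exact congrFun (hGc.trans hG₀c.symm) ⟨m, hmT⟩
    rw [← hder]
    obtain ⟨Q, rfl⟩ := hdvd
    simp only [derivative_mul, derivative_pow]
    exact ⟨C 2 * derivative P * Q + P * derivative Q, by simp; ring⟩
  · have e : G₀ = F - (F - G₀) := by ring
    have hle : G₀.natDegree ≤ F.natDegree := by
      rw [e]
      exact (natDegree_sub_le _ _).trans
        (max_le le_rfl ((natDegree_le_iff_degree_le.2 hI₀).trans hF))
    exact (natDegree_derivative_le _).trans ((Nat.sub_le _ _).trans hle)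

/-- **Bound on Σ₃ (squarefree case).** Let `F` be monic of degree `n` and `0 < h < n`.
The number of `G ∈ I_q(F,h)` divisible by `P²` for some irreducible `P` with
`deg P > h` is at most `(n/(h+1))·q^{h − ⌊h/p⌋} + q^{⌊h/p⌋ + 1}`. -/
theorem sigma3_bound_squarefree
    {Fq : Type} [Field Fq] [Fintype Fq] (q p n h : ℕ) [CharP Fq p]
    (hq : Fintype.card Fq = q)
    (F : Polynomial Fq) (hF : F.Monic) (hFdeg : F.natDegree = n)
    (hh0 : 0 < h) (hhn : h < n) :
    ({G : Polynomial Fq | (F - G).degree ≤ (h : WithBot ℕ) ∧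
        ∃ P : Polynomial Fq, Irreducible P ∧ h < P.natDegree ∧ P ^ 2 ∣ G}.ncard : ℝ)
      ≤ (n : ℝ) / ((h : ℝ) + 1) * (q : ℝ) ^ (h - h / p) + (q : ℝ) ^ (h / p + 1) := by
  classical
  subst hq hFdeg
  have hfin : {G : Fq[X] | (F - G).degree ≤ (h : WithBot ℕ) ∧
      ∃ P : Fq[X], Irreducible P ∧ h < P.natDegree ∧ P ^ 2 ∣ G}.Finite :=
    (finite_setOf_degree_sub_le F h).subset fun _ hG => hG.1
  rw [Set.ncard_eq_toFinset_card _ hfin,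
    ← Finset.card_filter_add_card_filter_not (fun G : Fq[X] => derivative G ≠ 0)]
  have h₁ := card_le_of_sq_dvd_of_derivative_ne_zero p hhn.le
    (hfin.toFinset.filter fun G => derivative G ≠ 0) fun G hG => by
      obtain ⟨hG, hd⟩ := Finset.mem_filter.1 hG
      obtain ⟨hI, hP⟩ := hfin.mem_toFinset.1 hG
      exact ⟨hI, hd, hP⟩
  have h₂ := card_le_of_derivative_eq p (F := F) (D := 0) (h := h)
    (hfin.toFinset.filter fun G => ¬ derivative G ≠ 0) fun G hG => by
      obtain ⟨hG, hd⟩ := Finset.mem_filter.1 hG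
      exact ⟨(hfin.mem_toFinset.1 hG).1, not_not.1 hd⟩
  have hdiv : ((F.natDegree / (h + 1) : ℕ) : ℝ) ≤ (F.natDegree : ℝ) / ((h : ℝ) + 1) := by
    exact_mod_cast Nat.cast_div_le (α := ℝ) (m := F.natDegree) (n := h + 1)
  rw [Nat.cast_add]
  refine add_le_add ?_ (by exact_mod_cast h₂)
  calc _ ≤ ((F.natDegree / (h + 1) * Fintype.card Fq ^ (h - h / p) : ℕ) : ℝ) := by
        exact_mod_cast h₁
    _ ≤ _ := by
        push_cast
        gcongr
end

section
/- Let F_q be a finite field with q elements of characteristic p, let F ∈ F_q[x] be monic of degree n, and let h be an integer with 2 ≤ h < n. Let N_q(F,h) be the number of polynomials in I_q(F,h) that are NOT squarefree. Then N_q(F,h) ≤ q^{h+1}·( ln(q/(q−1)) + (q+1)/((q−1)q·h) + n·q^{−(h+1)/p}/(h+1) + q^{h(1/p − 1)} ). -/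
open Polynomial

section Counting

variable {K : Type*} [Field K]

theorem exists_monic_irreducible_sq_dvd {P Q : K[X]} (hP : Irreducible P) (hPQ : P ^ 2 ∣ Q) :
    ∃ R : K[X], R.Monic ∧ Irreducible R ∧ R ^ 2 ∣ Q := by
  classical
  have hassoc := associated_normalize P
  exact ⟨normalize P, monic_normalize hP.ne_zero, hassoc.irreducible hP,
    (hassoc.pow_pow (n := 2)).dvd_iff_dvd_left.1 hPQ⟩

theorem card_mul_le_natDegree_of_irreducible_dvd_s17 {g : K[X]} (hg : g ≠ 0) {m : ℕ}
    (s : Finset K[X])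
    (hs : ∀ P ∈ s, P.Monic ∧ Irreducible P ∧ m ≤ P.natDegree ∧ P ∣ g) :
    s.card * m ≤ g.natDegree := by
  have hdvd : ∏ P ∈ s, P ∣ g := by
    refine Finset.prod_dvd_of_coprime (fun P hP Q hQ hPQ => ?_) fun P hP => (hs P hP).2.2.2
    obtain ⟨hPm, hPi, -⟩ := hs P hP
    obtain ⟨hQm, hQi, -⟩ := hs Q hQ
    refine (hPi.coprime_iff_not_dvd).2 fun h => hPQ ?_
    exact eq_of_monic_of_associated hPm hQm (hPi.associated_of_dvd hQi h)
  calc s.card * m = ∑ _P ∈ s, m := by simp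
    _ ≤ ∑ P ∈ s, P.natDegree := Finset.sum_le_sum fun P hP => (hs P hP).2.2.1
    _ = (∏ P ∈ s, P).natDegree := (natDegree_prod_of_monic _ _ fun P hP => (hs P hP).1).symm
    _ ≤ g.natDegree := natDegree_le_of_dvd hdvd hg

theorem coeff_eq_of_sub_mem_degreeLT {F Q : K[X]} {k i : ℕ} (hQ : F - Q ∈ degreeLT K k)
    (hi : k ≤ i) : Q.coeff i = F.coeff i := by
  have := coeff_eq_zero_of_degree_lt ((mem_degreeLT.1 hQ).trans_le (Nat.cast_le.2 hi))
  rw [coeff_sub, sub_eq_zero] at this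
  exact this.symm

variable [Fintype K]

theorem finite_degreeLT (k : ℕ) : (degreeLT K k : Set K[X]).Finite :=
  Set.finite_coe_iff.1 <| Finite.of_equiv _ (degreeLTEquiv K k).toEquiv.symm

theorem ncard_degreeLT (k : ℕ) : (degreeLT K k : Set K[X]).ncard = Fintype.card K ^ k := by
  rw [← Nat.card_coe_set_eq]
  exact (Nat.card_congr (degreeLTEquiv K k).toEquiv).trans (by simp)

theorem finite_interval (F : K[X]) (k : ℕ) : {Q : K[X] | F - Q ∈ degreeLT K k}.Finite :=
  (finite_degreeLT k).preimage (sub_right_injective.injOn)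

theorem ncard_interval_dvd_le (F M : K[X]) (hM : M.Monic) (k : ℕ) :
    {Q : K[X] | F - Q ∈ degreeLT K k ∧ M ∣ Q}.ncard ≤ Fintype.card K ^ (k - M.natDegree) := by
  rcases Set.eq_empty_or_nonempty {Q : K[X] | F - Q ∈ degreeLT K k ∧ M ∣ Q} with
    h | ⟨Q₀, hQ₀, R₀, rfl⟩
  · simp [h]
  rw [← ncard_degreeLT]
  refine Set.ncard_le_ncard_of_injOn (fun Q => R₀ - Q /ₘ M) ?_ ?_ (finite_degreeLT _)
  · rintro _ ⟨hQ, R, rfl⟩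
    have h := (degreeLT K k).sub_mem hQ hQ₀
    rw [sub_sub_sub_cancel_left, ← mul_sub, mem_degreeLT] at h
    simp only [mul_divByMonic_cancel_left _ hM, SetLike.mem_coe, mem_degreeLT]
    rcases eq_or_ne (R₀ - R) 0 with h0 | h0
    · simp [h0]
    rw [degree_mul, degree_eq_natDegree h0, degree_eq_natDegree hM.ne_zero] at h
    rw [degree_eq_natDegree h0]
    norm_cast at h ⊢
    omega
  · rintro _ ⟨-, R, rfl⟩ _ ⟨-, S, rfl⟩ h
    simp only [mul_divByMonic_cancel_left _ hM, sub_right_inj] at h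
    rw [h]

theorem irreducible_dvd_X_pow_card_pow_natDegree_sub_X {P : K[X]} (hP : Irreducible P) :
    P ∣ X ^ Fintype.card K ^ P.natDegree - X := by
  have := Fact.mk hP
  have hfin : Module.Finite K (AdjoinRoot P) := (AdjoinRoot.powerBasis hP.ne_zero).finite
  have : Finite (AdjoinRoot P) := Module.finite_of_finite K
  have := Fintype.ofFinite (AdjoinRoot P)
  have hcard : Fintype.card (AdjoinRoot P) = Fintype.card K ^ P.natDegree := by
    rw [Module.card_eq_pow_finrank (K := K), (AdjoinRoot.powerBasis hP.ne_zero).finrank,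
      AdjoinRoot.powerBasis_dim]
  rw [← AdjoinRoot.mk_eq_zero, map_sub, map_pow, ← hcard, FiniteField.pow_card, sub_self]

/-- The monic irreducible polynomials of degree `d`. -/
def monicIrreducibles (K : Type*) [Field K] (d : ℕ) : Set K[X] :=
  {P | P.Monic ∧ Irreducible P ∧ P.natDegree = d}

theorem finite_monicIrreducibles (d : ℕ) : (monicIrreducibles K d).Finite :=
  (finite_degreeLT (d + 1)).subset fun P hP => by
    simp only [SetLike.mem_coe, mem_degreeLT]
    exact degree_le_natDegree.trans_lt (by rw [hP.2.2]; exact_mod_cast d.lt_succ_self)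

theorem ncard_monicIrreducibles_mul_le {d : ℕ} (hd : d ≠ 0) :
    (monicIrreducibles K d).ncard * d ≤ Fintype.card K ^ d := by
  rw [Set.ncard_eq_toFinset_card _ (finite_monicIrreducibles d),
    ← FiniteField.X_pow_card_pow_sub_X_natDegree_eq K hd Fintype.one_lt_card]
  refine card_mul_le_natDegree_of_irreducible_dvd_s17
    (FiniteField.X_pow_card_pow_sub_X_ne_zero K hd Fintype.one_lt_card) _ fun P hP => ?_
  obtain ⟨h1, h2, rfl⟩ := (Set.Finite.mem_toFinset _).1 hP
  exact ⟨h1, h2, le_rfl, irreducible_dvd_X_pow_card_pow_natDegree_sub_X h2⟩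

theorem ncard_interval_dvd_sq_le (F : K[X]) (k d : ℕ) :
    {Q : K[X] | F - Q ∈ degreeLT K k ∧ ∃ P ∈ monicIrreducibles K d, P ^ 2 ∣ Q}.ncard ≤
      (monicIrreducibles K d).ncard * Fintype.card K ^ (k - 2 * d) := by
  have heq : {Q : K[X] | F - Q ∈ degreeLT K k ∧ ∃ P ∈ monicIrreducibles K d, P ^ 2 ∣ Q} =
      ⋃ P ∈ (finite_monicIrreducibles (K := K) d).toFinset,
        {Q : K[X] | F - Q ∈ degreeLT K k ∧ P ^ 2 ∣ Q} := by
    ext Q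
    simp
  rw [heq, Set.ncard_eq_toFinset_card _ (finite_monicIrreducibles d)]
  refine (Finset.set_ncard_biUnion_le _ _).trans (Finset.sum_le_card_nsmul _ _ _ fun P hP => ?_)
  obtain ⟨hm, -, rfl⟩ := (Set.Finite.mem_toFinset _).1 hP
  simpa [hm.natDegree_pow] using ncard_interval_dvd_le F (P ^ 2) (hm.pow 2) k

theorem ncard_interval_dvd_sq_range_le (F : K[X]) (h : ℕ) (a b : ℕ) (ha : a ≠ 0) :
    ({Q : K[X] | F - Q ∈ degreeLT K h ∧
      ∃ d ∈ Finset.Ico a b, ∃ P ∈ monicIrreducibles K d, P ^ 2 ∣ Q}.ncard : ℝ) ≤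
      ∑ d ∈ Finset.Ico a b,
        (Fintype.card K : ℝ) ^ d / d * (Fintype.card K : ℝ) ^ (h - 2 * d) := by
  have heq : {Q : K[X] | F - Q ∈ degreeLT K h ∧
      ∃ d ∈ Finset.Ico a b, ∃ P ∈ monicIrreducibles K d, P ^ 2 ∣ Q} =
      ⋃ d ∈ Finset.Ico a b,
        {Q : K[X] | F - Q ∈ degreeLT K h ∧ ∃ P ∈ monicIrreducibles K d, P ^ 2 ∣ Q} := by
    ext Q
    simp only [Set.mem_ofPred_eq, Set.mem_iUnion, exists_prop]
    tauto
  rw [heq]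
  refine (Nat.cast_le.2 (Finset.set_ncard_biUnion_le _ _)).trans ?_
  push_cast
  refine Finset.sum_le_sum fun d hd => ?_
  have hd0 : d ≠ 0 := by have := (Finset.mem_Ico.1 hd).1; omega
  have hd0' : (0 : ℝ) < d := by positivity
  refine (Nat.cast_le.2 (ncard_interval_dvd_sq_le F h d)).trans ?_
  push_cast
  gcongr
  rw [le_div_iff₀ hd0']
  exact_mod_cast ncard_monicIrreducibles_mul_le hd0

/-! ### Fibres and image of the derivative on an interval -/

theorem ncard_interval_derivative_eq_le (F g : K[X]) (p h : ℕ) [CharP K p] :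
    {Q : K[X] | F - Q ∈ degreeLT K (h + 1) ∧ derivative Q = g}.ncard ≤
      Fintype.card K ^ (h / p + 1) := by
  have hp : p.Prime := CharP.char_is_prime K p
  have hcard : (Set.univ : Set (Fin (h / p + 1) → K)).ncard = Fintype.card K ^ (h / p + 1) := by
    simp [Set.ncard_univ]
  rw [← hcard]
  refine Set.ncard_le_ncard_of_injOn (fun Q j => Q.coeff (p * j)) (by simp) ?_
  rintro Q₁ ⟨h₁, hd₁⟩ Q₂ ⟨h₂, hd₂⟩ heq
  ext i
  rcases Nat.lt_or_ge h i with hi | hi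
  · rw [coeff_eq_of_sub_mem_degreeLT h₁ hi, coeff_eq_of_sub_mem_degreeLT h₂ hi]
  by_cases hpi : p ∣ i
  · obtain ⟨j, rfl⟩ := hpi
    have hj : j < h / p + 1 := by
      rw [Nat.lt_succ_iff, Nat.le_div_iff_mul_le hp.pos, mul_comm]
      exact hi
    exact congrFun heq ⟨j, hj⟩
  · obtain ⟨i, rfl⟩ : ∃ j, i = j + 1 := ⟨i - 1, by
      have : i ≠ 0 := by rintro rfl; simp at hpi
      omega⟩
    have hne : ((i : K) + 1) ≠ 0 := by
      have := (CharP.cast_eq_zero_iff K p (i + 1)).not.2 hpi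
      exact_mod_cast this
    have := congrArg (fun f => coeff f i) (hd₁.trans hd₂.symm)
    simpa [coeff_derivative, hne] using this

theorem card_filter_not_dvd_range {p : ℕ} (hp : p ≠ 0) (h : ℕ) :
    ((Finset.range (h + 1)).filter fun i => ¬ p ∣ i).card + (h / p + 1) ≤ h + 1 := by
  have h1 := Finset.card_filter_add_card_filter_not (s := Finset.range (h + 1)) (fun i => p ∣ i)
  have h2 : h / p + 1 ≤ ((Finset.range (h + 1)).filter fun i => p ∣ i).card := by
    rw [← Finset.card_range (h / p + 1)]
    refine Finset.card_le_card_of_injOn (fun j => p * j) (fun j hj => ?_)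
      ((mul_right_injective₀ hp).injOn)
    have hj' : j ≤ h / p := by simpa [Nat.lt_succ_iff] using hj
    have := (Nat.mul_le_mul_left p hj').trans (Nat.mul_div_le h p)
    simp
    omega
  rw [Finset.card_range] at h1
  omega

theorem ncard_derivative_image_interval_le (F : K[X]) (p h : ℕ) [CharP K p] :
    (derivative '' {Q : K[X] | F - Q ∈ degreeLT K (h + 1)}).ncard ≤
      Fintype.card K ^ ((Finset.range (h + 1)).filter fun i => ¬ p ∣ i).card := by
  set s := (Finset.range (h + 1)).filter fun i => ¬ p ∣ i with hs
  have hcard : (Set.univ : Set (s → K)).ncard = Fintype.card K ^ s.card := by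
    simp [Set.ncard_univ]
  rw [← hcard]
  refine Set.ncard_le_ncard_of_injOn (fun g i => g.coeff (i - 1)) (by simp) ?_
  rintro _ ⟨Q₁, h₁, rfl⟩ _ ⟨Q₂, h₂, rfl⟩ heq
  ext i
  rcases Nat.lt_or_ge h (i + 1) with hi | hi
  · rw [coeff_derivative, coeff_derivative, coeff_eq_of_sub_mem_degreeLT h₁ hi,
      coeff_eq_of_sub_mem_degreeLT h₂ hi]
  by_cases hpi : p ∣ i + 1
  · have : ((i : K) + 1) = 0 := by exact_mod_cast (CharP.cast_eq_zero_iff K p (i + 1)).2 hpi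
    simp [coeff_derivative, this]
  · have hmem : i + 1 ∈ s := by
      simp only [hs, Finset.mem_filter, Finset.mem_range]
      exact ⟨by omega, hpi⟩
    exact congrFun heq ⟨i + 1, hmem⟩

theorem ncard_interval_dvd_derivative_eq_le {F g : K[X]} (hg : g ≠ 0) {k m : ℕ} (hm : m ≠ 0)
    (hkm : k ≤ m) :
    {Q : K[X] | F - Q ∈ degreeLT K k ∧ derivative Q = g ∧
      ∃ P : K[X], P.Monic ∧ Irreducible P ∧ m ≤ P.natDegree ∧ P ^ 2 ∣ Q}.ncard ≤
      g.natDegree / m := by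
  set A := {Q : K[X] | F - Q ∈ degreeLT K k ∧ derivative Q = g ∧
      ∃ P : K[X], P.Monic ∧ Irreducible P ∧ m ≤ P.natDegree ∧ P ^ 2 ∣ Q} with hA
  have hAf : A.Finite := (finite_interval F k).subset fun Q hQ => hQ.1
  choose! f hf using fun Q (hQ : Q ∈ A) => hQ.2.2
  classical
  have hinj : Set.InjOn f A := by
    intro Q₁ h₁ Q₂ h₂ heq
    obtain ⟨-, -, hdeg, hd₁⟩ := hf Q₁ h₁
    obtain ⟨-, -, -, hd₂⟩ := hf Q₂ h₂
    have hdvd : f Q₁ ∣ Q₂ - Q₁ :=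
      dvd_sub ((dvd_pow_self _ two_ne_zero).trans (heq ▸ hd₂))
        ((dvd_pow_self _ two_ne_zero).trans hd₁)
    have hlt := (degreeLT K k).sub_mem h₁.1 h₂.1
    rw [sub_sub_sub_cancel_left, mem_degreeLT] at hlt
    by_contra hne
    have hne' : Q₂ - Q₁ ≠ 0 := sub_ne_zero.2 (Ne.symm hne)
    have h3 := natDegree_le_of_dvd hdvd hne'
    rw [degree_eq_natDegree hne', Nat.cast_lt] at hlt
    omega
  rw [Nat.le_div_iff_mul_le (Nat.pos_of_ne_zero hm), ← hinj.ncard_image,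
    Set.ncard_eq_toFinset_card _ (hAf.image f)]
  refine card_mul_le_natDegree_of_irreducible_dvd_s17 hg _ fun P hP => ?_
  obtain ⟨Q, hQ, rfl⟩ := (Set.Finite.mem_toFinset _).1 hP
  obtain ⟨h1, h2, h3, R, hR⟩ := hf Q hQ
  refine ⟨h1, h2, h3, ?_⟩
  rw [← hQ.2.1]
  generalize f Q = P at hR
  rw [hR, derivative_mul, derivative_sq]
  exact ⟨C 2 * derivative P * R + P * derivative R, by ring⟩

theorem ncard_interval_dvd_sq_large_le (F : K[X]) (p h : ℕ) [CharP K p]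
    (hF : h < F.natDegree) :
    {Q : K[X] | F - Q ∈ degreeLT K (h + 1) ∧ derivative Q ≠ 0 ∧
      ∃ P : K[X], P.Monic ∧ Irreducible P ∧ h + 1 ≤ P.natDegree ∧ P ^ 2 ∣ Q}.ncard ≤
      Fintype.card K ^ ((Finset.range (h + 1)).filter fun i => ¬ p ∣ i).card *
        (F.natDegree / (h + 1)) := by
  have hfin := (finite_interval F (h + 1)).image derivative
  classical
  refine (Set.ncard_le_ncard (t := ⋃ g ∈ hfin.toFinset.filter (· ≠ 0),
    {Q : K[X] | F - Q ∈ degreeLT K (h + 1) ∧ derivative Q = g ∧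
      ∃ P : K[X], P.Monic ∧ Irreducible P ∧ h + 1 ≤ P.natDegree ∧ P ^ 2 ∣ Q}) ?_ ?_).trans ?_
  · rintro Q ⟨h1, h2, h3⟩
    simp only [Set.mem_iUnion]
    exact ⟨derivative Q, by simpa [h2] using ⟨Q, h1, rfl⟩, h1, rfl, h3⟩
  · refine Set.Finite.biUnion (Finset.finite_toSet _) fun g _ => ?_
    exact (finite_interval F (h + 1)).subset fun Q hQ => hQ.1
  refine (Finset.set_ncard_biUnion_le _ _).trans ?_
  refine (Finset.sum_le_card_nsmul _ _ (F.natDegree / (h + 1)) fun g hg => ?_).trans ?_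
  · obtain ⟨hg, hg0⟩ := Finset.mem_filter.1 hg
    obtain ⟨Q, hQ, rfl⟩ := (Set.Finite.mem_toFinset _).1 hg
    refine (ncard_interval_dvd_derivative_eq_le hg0 h.succ_ne_zero le_rfl).trans ?_
    refine Nat.div_le_div_right ((natDegree_derivative_le Q).trans ((Nat.sub_le _ _).trans ?_))
    refine natDegree_le_iff_coeff_eq_zero.2 fun i hi => ?_
    rw [coeff_eq_of_sub_mem_degreeLT hQ (by omega), coeff_eq_zero_of_natDegree_lt hi]
  · rw [smul_eq_mul]
    refine Nat.mul_le_mul_right _ ((Finset.card_filter_le _ _).trans ?_)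
    rw [← Set.ncard_eq_toFinset_card _ hfin]
    exact ncard_derivative_image_interval_le F p h

end Counting

section RealEstimates

theorem sum_small_degree_le {x : ℝ} (hx : 1 < x) {k m : ℕ} (hm : 2 * m ≤ k + 2) :
    ∑ d ∈ Finset.Ico 1 m, x ^ d / d * x ^ (k - 2 * d) ≤ x ^ k * Real.log (x / (x - 1)) := by
  have hx0 : 0 < x := by linarith
  have hinv : |x⁻¹| < 1 := by
    rw [abs_of_pos (inv_pos.2 hx0)]
    exact inv_lt_one_of_one_lt₀ hx
  have hlog : Real.log (x / (x - 1)) = -Real.log (1 - x⁻¹) := by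
    rw [← Real.log_inv]
    congr 1
    field_simp
  have hsum := sum_le_hasSum (Finset.range (m - 1)) (fun i _ => by positivity)
    (Real.hasSum_pow_div_log_of_abs_lt_one hinv)
  rw [hlog]
  refine le_trans (le_of_eq ?_) (mul_le_mul_of_nonneg_left hsum (pow_pos hx0 k).le)
  rw [Finset.sum_Ico_eq_sum_range, Finset.mul_sum]
  refine Finset.sum_congr rfl fun i hi => ?_
  have hi' := Finset.mem_range.1 hi
  obtain ⟨j, rfl⟩ : ∃ j, k = j + 2 * (1 + i) := ⟨k - 2 * (1 + i), by omega⟩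
  rw [Nat.add_sub_cancel]
  push_cast
  rw [inv_pow]
  field_simp
  ring

theorem sum_medium_degree_le {x : ℝ} (hx : 1 < x) {h m : ℕ} (hm : h ≤ 2 * m) (hm0 : 0 < m)
    (hmh : m ≤ h) :
    ∑ d ∈ Finset.Ico m (h + 1), x ^ d / d ≤ x ^ h * (x + 1) / ((x - 1) * h) := by
  have hx1 : 0 < x - 1 := by linarith
  have hh : (0 : ℝ) < h := by exact_mod_cast hm0.trans_le hmh
  have hgeom : ∑ d ∈ Finset.Ico m h, x ^ d ≤ x ^ h / (x - 1) := by
    rw [geom_sum_Ico hx.ne' hmh]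
    gcongr
    linarith [pow_pos (zero_lt_one.trans hx) m]
  have hterm : ∑ d ∈ Finset.Ico m h, x ^ d / d ≤ 2 / h * ∑ d ∈ Finset.Ico m h, x ^ d := by
    rw [Finset.mul_sum]
    refine Finset.sum_le_sum fun d hd => ?_
    have hd := (Finset.mem_Ico.1 hd).1
    have hd0 : (0 : ℝ) < d := by exact_mod_cast hm0.trans_le hd
    have hhd : (h : ℝ) ≤ 2 * d := by exact_mod_cast hm.trans (by omega)
    rw [div_mul_eq_mul_div, div_le_div_iff₀ hd0 hh]
    nlinarith [pow_pos (zero_lt_one.trans hx) d]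
  rw [Finset.sum_Ico_succ_top hmh]
  calc _ ≤ 2 / h * (x ^ h / (x - 1)) + x ^ h / h := by
        gcongr
        exact hterm.trans (by gcongr)
    _ = x ^ h * (x + 1) / ((x - 1) * h) := by
        field_simp
        ring

theorem pow_card_mul_div_le {x : ℝ} (hx : 1 < x) {p c h n : ℕ} (hp : 0 < p)
    (hc : c + (h / p + 1) ≤ h + 1) :
    x ^ c * ((n / (h + 1) : ℕ) : ℝ) ≤
      x ^ (h + 1) * (n * x ^ (-(((h : ℝ) + 1) / p)) / (h + 1)) := by
  have hx0 : 0 < x := by linarith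
  have hdiv : ((h : ℝ) + 1) / p ≤ ((h / p : ℕ) : ℝ) + 1 := by
    rw [div_le_iff₀ (by exact_mod_cast hp)]
    exact_mod_cast Nat.succ_le_of_lt (by rw [mul_comm]; exact Nat.lt_mul_div_succ h hp)
  have hc' : (c : ℝ) + ((h / p : ℕ) + 1) ≤ h + 1 := by exact_mod_cast hc
  calc x ^ c * ((n / (h + 1) : ℕ) : ℝ)
      ≤ x ^ ((h : ℝ) + 1 + -(((h : ℝ) + 1) / p)) * (n / (h + 1)) := by
        gcongr
        · rw [← Real.rpow_natCast]
          exact Real.rpow_le_rpow_of_exponent_le hx.le (by linarith)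
        · exact_mod_cast Nat.cast_div_le (α := ℝ) (m := n) (n := h + 1)
    _ = x ^ (h + 1) * (n * x ^ (-(((h : ℝ) + 1) / p)) / (h + 1)) := by
        rw [Real.rpow_add hx0, ← Real.rpow_natCast x (h + 1)]
        push_cast
        ring

theorem pow_div_succ_le {x : ℝ} (hx : 1 < x) (p h : ℕ) :
    x ^ (h / p + 1) ≤ x ^ (h + 1) * x ^ ((h : ℝ) * (1 / (p : ℝ) - 1)) := by
  have hx0 : 0 < x := by linarith
  rw [← Real.rpow_natCast, ← Real.rpow_natCast, ← Real.rpow_add hx0]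
  refine Real.rpow_le_rpow_of_exponent_le hx.le ?_
  have := Nat.cast_div_le (α := ℝ) (m := h) (n := p)
  push_cast
  rw [mul_sub, mul_one_div]
  linarith

end RealEstimates

/-- **Bound (2.11).** For `F` monic of degree `n` and `2 ≤ h < n`, the number
`N_q(F,h)` of non-squarefree polynomials in `I_q(F,h)` satisfies
`N_q(F,h) ≤ q^{h+1}·(ln(q/(q−1)) + (q+1)/((q−1)qh) + n·q^{−(h+1)/p}/(h+1) + q^{h(1/p−1)})`. -/
theorem non_squarefree_count_bound
    {Fq : Type} [Field Fq] [Fintype Fq] (q p n h : ℕ) [CharP Fq p]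
    (hq : Fintype.card Fq = q)
    (F : Polynomial Fq) (hF : F.Monic) (hFdeg : F.natDegree = n)
    (hh0 : 2 ≤ h) (hhn : h < n) :
    ({Q : Polynomial Fq | (F - Q).degree ≤ (h : WithBot ℕ) ∧
        ∃ P : Polynomial Fq, Irreducible P ∧ P ^ 2 ∣ Q}.ncard : ℝ)
      ≤ (q : ℝ) ^ (h + 1) *
        (Real.log ((q : ℝ) / ((q : ℝ) - 1))
          + ((q : ℝ) + 1) / (((q : ℝ) - 1) * q * h)
          + (n : ℝ) * (q : ℝ) ^ (-(((h : ℝ) + 1) / (p : ℝ))) / ((h : ℝ) + 1)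
          + (q : ℝ) ^ ((h : ℝ) * (1 / (p : ℝ) - 1))) := by
  subst hq hFdeg
  have hp : p.Prime := CharP.char_is_prime Fq p
  have hx : (1 : ℝ) < (Fintype.card Fq : ℝ) := by exact_mod_cast Fintype.one_lt_card
  set m := (h + 1) / 2 + 1
  have hdeg (Q : Fq[X]) : (F - Q).degree ≤ (h : WithBot ℕ) ↔ F - Q ∈ degreeLT Fq (h + 1) := by
    rw [mem_degreeLT, degree_lt_iff_coeff_zero, degree_le_iff_coeff_zero]
    simp only [Nat.cast_lt, Nat.succ_le_iff]
  set A := {Q : Fq[X] | F - Q ∈ degreeLT Fq (h + 1) ∧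
    ∃ d ∈ Finset.Ico 1 m, ∃ P ∈ monicIrreducibles Fq d, P ^ 2 ∣ Q}
  set B := {Q : Fq[X] | F - Q ∈ degreeLT Fq (h + 1) ∧
    ∃ d ∈ Finset.Ico m (h + 1), ∃ P ∈ monicIrreducibles Fq d, P ^ 2 ∣ Q}
  set C := {Q : Fq[X] | F - Q ∈ degreeLT Fq (h + 1) ∧ derivative Q ≠ 0 ∧
    ∃ P : Fq[X], P.Monic ∧ Irreducible P ∧ h + 1 ≤ P.natDegree ∧ P ^ 2 ∣ Q}
  set D := {Q : Fq[X] | F - Q ∈ degreeLT Fq (h + 1) ∧ derivative Q = 0}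
  have hsub : {Q : Fq[X] | (F - Q).degree ≤ (h : WithBot ℕ) ∧
      ∃ P : Fq[X], Irreducible P ∧ P ^ 2 ∣ Q} ⊆ A ∪ B ∪ C ∪ D := by
    rintro Q ⟨hQ, P₀, hP₀, hdvd₀⟩
    rw [hdeg] at hQ
    obtain ⟨P, hPm, hP, hdvd⟩ := exists_monic_irreducible_sq_dvd hP₀ hdvd₀
    have hpos := hP.natDegree_pos
    rcases Nat.lt_or_ge P.natDegree m with h1 | h1
    · exact .inl (.inl (.inl ⟨hQ, _, Finset.mem_Ico.2 ⟨hpos, h1⟩, P, ⟨hPm, hP, rfl⟩, hdvd⟩))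
    rcases Nat.lt_or_ge P.natDegree (h + 1) with h2 | h2
    · exact .inl (.inl (.inr ⟨hQ, _, Finset.mem_Ico.2 ⟨h1, h2⟩, P, ⟨hPm, hP, rfl⟩, hdvd⟩))
    by_cases h3 : derivative Q = 0
    · exact .inr ⟨hQ, h3⟩
    · exact .inl (.inr ⟨hQ, h3, P, hPm, hP, h2, hdvd⟩)
  have hfin : (A ∪ B ∪ C ∪ D).Finite := (finite_interval F (h + 1)).subset <| by
    rintro Q (((hQ | hQ) | hQ) | hQ) <;> exact hQ.1
  have hunion : (A ∪ B ∪ C ∪ D).ncard ≤ A.ncard + B.ncard + C.ncard + D.ncard :=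
    (Set.ncard_union_le _ _).trans <| Nat.add_le_add_right ((Set.ncard_union_le _ _).trans <|
      Nat.add_le_add_right (Set.ncard_union_le _ _) _) _
  have hA := (ncard_interval_dvd_sq_range_le F (h + 1) 1 m one_ne_zero).trans
    (sum_small_degree_le hx (by omega))
  have hB : (B.ncard : ℝ) ≤ (Fintype.card Fq : ℝ) ^ (h + 1) *
      (((Fintype.card Fq : ℝ) + 1) / (((Fintype.card Fq : ℝ) - 1) * Fintype.card Fq * h)) := by
    refine (ncard_interval_dvd_sq_range_le F (h + 1) m (h + 1) (by omega)).trans ?_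
    have hone : ∀ d ∈ Finset.Ico m (h + 1), (Fintype.card Fq : ℝ) ^ d / d *
        (Fintype.card Fq : ℝ) ^ (h + 1 - 2 * d) = (Fintype.card Fq : ℝ) ^ d / d := by
      intro d hd
      have := (Finset.mem_Ico.1 hd).1
      rw [Nat.sub_eq_zero_of_le (by omega), pow_zero, mul_one]
    rw [Finset.sum_congr rfl hone]
    refine (sum_medium_degree_le hx (by omega) (by omega) (by omega)).trans (le_of_eq ?_)
    have : (Fintype.card Fq : ℝ) ≠ 0 := by positivity
    rw [pow_succ, ← mul_div_assoc, mul_right_comm _ (Fintype.card Fq : ℝ) (h : ℝ),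
      mul_right_comm _ (Fintype.card Fq : ℝ), mul_div_mul_right _ _ this]
  have hC : (C.ncard : ℝ) ≤ _ :=
    (Nat.cast_le.2 (ncard_interval_dvd_sq_large_le F p h hhn)).trans <| by
      push_cast
      exact pow_card_mul_div_le hx hp.pos (card_filter_not_dvd_range hp.ne_zero h)
  have hD : (D.ncard : ℝ) ≤ _ :=
    (Nat.cast_le.2 (ncard_interval_derivative_eq_le F 0 p h)).trans <| by
      push_cast
      exact pow_div_succ_le hx p h
  have htotal : ({Q : Fq[X] | (F - Q).degree ≤ (h : WithBot ℕ) ∧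
      ∃ P : Fq[X], Irreducible P ∧ P ^ 2 ∣ Q}.ncard : ℝ) ≤
      A.ncard + B.ncard + C.ncard + D.ncard := by
    exact_mod_cast (Set.ncard_le_ncard hsub hfin).trans hunion
  rw [mul_add, mul_add, mul_add]
  linarith
end

section
/- Let F_q be a finite field with q elements, let k ≥ 2 and let h be an integer with h ≥ k. Then ∑_{1 ≤ d ≤ h/k} π_q(d)·q^{h − k·d + 1} < q^{h+1}·ln(ζ_q(k)), where π_q(d) is the number of monic irreducible polynomials of degree d in F_q[x] and ζ_q(k) = (1 − q^{1−k})^{−1}. -/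
open Polynomial

/-- Over a finite field with `q` elements, `d` times the number of monic irreducible polynomials of
degree `d` is at most `q ^ d`. -/
theorem natDegree_mul_ncard_monic_irreducible_le (F : Type*) [Field F] [Fintype F] {d : ℕ}
    (hd : d ≠ 0) :
    d * {P : F[X] | P.Monic ∧ Irreducible P ∧ P.natDegree = d}.ncard ≤ Fintype.card F ^ d := by
  set S := {P : F[X] | P.Monic ∧ Irreducible P ∧ P.natDegree = d}
  by_cases hS : S.Finite
  · have hmem : ∀ P ∈ hS.toFinset, P.Monic ∧ Irreducible P ∧ P.natDegree = d :=
      fun P hP => hS.mem_toFinset.1 hP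
    have hdvd : ∏ P ∈ hS.toFinset, P ∣ X ^ Fintype.card F ^ d - X := by
      refine Finset.prod_dvd_of_coprime (fun P hP Q hQ hPQ => ?_) fun P hP => ?_
      · obtain ⟨hPm, hPi, -⟩ := hmem P hP
        obtain ⟨hQm, hQi, -⟩ := hmem Q hQ
        exact (hPi.isCoprime_or_dvd Q).resolve_right fun h =>
          hPQ (eq_of_monic_of_associated hPm hQm (hPi.associated_of_dvd hQi h))
      · obtain ⟨-, hPi, hPd⟩ := hmem P hP
        have := hPi.natDegree_dvd_iff_dvd_X_pow_card_pow_sub_X.1 hPd.dvd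
        rwa [Nat.card_eq_fintype_card] at this
    have hle := natDegree_le_of_dvd hdvd
      (FiniteField.X_pow_card_pow_sub_X_ne_zero F hd Fintype.one_lt_card)
    rw [FiniteField.X_pow_card_pow_sub_X_natDegree_eq F hd Fintype.one_lt_card,
      natDegree_prod_of_monic _ _ fun P hP => (hmem P hP).1,
      Finset.sum_congr rfl fun P hP => (hmem P hP).2.2, Finset.sum_const, smul_eq_mul] at hle
    rwa [Set.ncard_eq_toFinset_card S hS, mul_comm]
  · simp [Set.Infinite.ncard hS]

/-- Every partial sum of the series of `-log (1 - x)` is strictly smaller than its limit when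
`0 < x < 1`. -/
theorem sum_Icc_pow_div_lt_neg_log_one_sub {x : ℝ} (hx₀ : 0 < x) (hx₁ : x < 1) (n : ℕ) :
    ∑ d ∈ Finset.Icc 1 n, x ^ d / d < -Real.log (1 - x) := by
  have hsum := Real.hasSum_pow_div_log_of_abs_lt_one (abs_lt.2 ⟨by linarith, hx₁⟩)
  have hle := sum_le_hasSum (Finset.range (n + 1)) (fun i _ => by positivity) hsum
  have hpos : 0 < x ^ (n + 1) / ((n : ℝ) + 1) := by positivity
  have hIcc : ∑ d ∈ Finset.Icc 1 n, x ^ d / d =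
      ∑ i ∈ Finset.range n, x ^ (i + 1) / ((i : ℝ) + 1) := by
    rw [Finset.range_eq_Ico, ← Finset.Ico_add_one_right_eq_Icc,
      ← Finset.sum_Ico_add' (fun d : ℕ => x ^ d / (d : ℝ)) 0 n 1]
    simp
  rw [Finset.sum_range_succ] at hle
  linarith

/-- **Bound (2.4).** For `k ≥ 2` and `h ≥ k`,
`∑_{1 ≤ d ≤ h/k} π_q(d)·q^{h−kd+1} < q^{h+1}·ln ζ_q(k)`, where
`ζ_q(k) = (1 − q^{1−k})⁻¹`. -/
theorem sigma1_bound
    {Fq : Type} [Field Fq] [Fintype Fq] (q k h : ℕ) (hq : Fintype.card Fq = q)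
    (hk : 2 ≤ k) (hhk : k ≤ h) :
    ∑ d ∈ Finset.Icc 1 (h / k),
        ({P : Polynomial Fq | P.Monic ∧ Irreducible P ∧ P.natDegree = d}.ncard : ℝ) *
          (q : ℝ) ^ (h - k * d + 1)
      < (q : ℝ) ^ (h + 1) * Real.log ((1 - (q : ℝ) ^ (1 - (k : ℤ)))⁻¹) := by
  have hq₁ : (1 : ℝ) < q := by exact_mod_cast hq ▸ Fintype.one_lt_card (α := Fq)
  have hq₀ : (0 : ℝ) < q := by linarith
  set x : ℝ := (q : ℝ) ^ (1 - (k : ℤ)) with hx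
  have hx₀ : 0 < x := zpow_pos hq₀ _
  have hx₁ : x < 1 := zpow_lt_one_of_neg₀ hq₁ (by omega)
  rw [Real.log_inv]
  refine lt_of_le_of_lt ?_ (mul_lt_mul_of_pos_left
    (sum_Icc_pow_div_lt_neg_log_one_sub hx₀ hx₁ (h / k)) (pow_pos hq₀ (h + 1)))
  rw [Finset.mul_sum]
  refine Finset.sum_le_sum fun d hd => ?_
  obtain ⟨hd₁, hdk⟩ := Finset.mem_Icc.1 hd
  have hkd : k * d ≤ h := (Nat.mul_le_mul_left k hdk).trans (Nat.mul_div_le h k)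
  have hd₀ : (0 : ℝ) < d := by exact_mod_cast hd₁
  have hcount : (d : ℝ) * ({P : Fq[X] | P.Monic ∧ Irreducible P ∧ P.natDegree = d}.ncard : ℝ)
      ≤ (q : ℝ) ^ d := by
    exact_mod_cast hq ▸ natDegree_mul_ncard_monic_irreducible_le Fq (by omega : d ≠ 0)
  have hpow : (q : ℝ) ^ (h + 1) * x ^ d = (q : ℝ) ^ d * (q : ℝ) ^ (h - k * d + 1) := by
    rw [hx, ← zpow_natCast, ← zpow_natCast, ← zpow_natCast, ← zpow_natCast, ← zpow_mul,
      ← zpow_add₀ hq₀.ne', ← zpow_add₀ hq₀.ne']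
    push_cast [Nat.cast_sub hkd]
    ring_nf
  rw [← mul_div_assoc, hpow, le_div_iff₀ hd₀]
  calc _ = _ * (q : ℝ) ^ (h - k * d + 1) := by rw [mul_right_comm, mul_comm _ (d : ℝ)]
    _ ≤ _ := mul_le_mul_of_nonneg_right hcount (by positivity)
end
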